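/- arXiv:1503.06322 — 11 statements merged into one kernel-verified Lean document; each statement's English description precedes it below -/
import Mathlib

section
/- For every n ≥ 1, ε_n ≥ 0 and ε_{n+1} ≤ (1/2)·ε_n. -/
/-- In terms of `e = x - 3/4`, the recursion map is `e ↦ 3√(1 + e) - 3 - e`, which is at most
`e / 2`. -/
theorem recursion_sub_le_half {x : ℝ} (hx : 3 / 4 ≤ x) :
    (3 / 2) * Real.sqrt (1 + 4 * x) - 3 / 2 - x - 3 / 4 ≤ (1 / 2) * (x - 3 / 4) := by
  have h : Real.sqrt (1 + 4 * x) ≤ x + 5 / 4 :=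
    Real.sqrt_le_iff.mpr ⟨by linarith, by nlinarith [sq_nonneg (x - 3 / 4)]⟩
  linarith

theorem le_recursion {x : ℝ} (hx : 3 / 4 ≤ x) (hx' : x ≤ 15 / 4) :
    3 / 4 ≤ (3 / 2) * Real.sqrt (1 + 4 * x) - 3 / 2 - x := by
  have h : (2 / 3) * x + 3 / 2 ≤ Real.sqrt (1 + 4 * x) :=
    Real.le_sqrt_of_sq_le (by nlinarith [mul_nonneg (sub_nonneg.mpr hx) (sub_nonneg.mpr hx')])
  linarith

/-- Let `(q_n)_{n≥1}` be defined by `q 1 = (√45 − 5)/2` and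
`q (n+1) = (3/2)·√(1 + 4·q n) − 3/2 − q n`, and let `ε n = q n − 3/4`.
Then for every `n ≥ 1`, `ε n ≥ 0` and `ε (n+1) ≤ (1/2)·ε n`. -/
theorem eps_nonneg_and_halving (q : ℕ → ℝ)
    (hq1 : q 1 = (Real.sqrt 45 - 5) / 2)
    (hqrec : ∀ n, 1 ≤ n → q (n + 1) = (3 / 2) * Real.sqrt (1 + 4 * q n) - 3 / 2 - q n) :
    ∀ n, 1 ≤ n → 0 ≤ q n - 3 / 4 ∧ q (n + 1) - 3 / 4 ≤ (1 / 2) * (q n - 3 / 4) := by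
  have hbound : ∀ n, 1 ≤ n → 3 / 4 ≤ q n ∧ q n ≤ 15 / 4 := by
    intro n hn
    induction n, hn using Nat.le_induction with
    | base =>
      have hl : (13 / 2 : ℝ) ≤ Real.sqrt 45 := Real.le_sqrt_of_sq_le (by norm_num)
      have hu : Real.sqrt 45 ≤ 7 := Real.sqrt_le_iff.mpr (by norm_num)
      rw [hq1]
      constructor <;> linarith
    | succ n hn ih =>
      rw [hqrec n hn]
      exact ⟨le_recursion ih.1 ih.2, by linarith [recursion_sub_le_half ih.1, ih.2]⟩
  intro n hn
  refine ⟨sub_nonneg.mpr (hbound n hn).1, ?_⟩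
  rw [hqrec n hn]
  exact recursion_sub_le_half (hbound n hn).1
end

section
/- For every n ≥ 1, ε_n ≤ 2^{−(n+2)}. -/
/-- Let `(q_n)_{n≥1}` be defined by `q 1 = (√45 − 5)/2` and
`q (n+1) = (3/2)·√(1 + 4·q n) − 3/2 − q n`, and let `ε n = q n − 3/4`.
Then for every `n ≥ 1`, `ε n ≤ 2^{-(n+2)}`. -/
theorem eps_upper_bound (q : ℕ → ℝ)
    (hq1 : q 1 = (Real.sqrt 45 - 5) / 2)
    (hqrec : ∀ n, 1 ≤ n → q (n + 1) = (3 / 2) * Real.sqrt (1 + 4 * q n) - 3 / 2 - q n) :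
    ∀ n, 1 ≤ n → q n - 3 / 4 ≤ 1 / 2 ^ (n + 2) := by
  suffices h : ∀ n, 1 ≤ n → 3 / 4 ≤ q n ∧ q n - 3 / 4 ≤ 1 / 2 ^ (n + 2) from
    fun n hn => (h n hn).2
  intro n hn
  induction n, hn using Nat.le_induction with
  | base =>
    have hlo : 13 / 2 ≤ √(45 : ℝ) := Real.le_sqrt_of_sq_le (by norm_num)
    have hhi : √(45 : ℝ) ≤ 27 / 4 := Real.sqrt_le_iff.mpr (by norm_num)
    rw [hq1]
    constructor
    · linarith
    · norm_num
      linarith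
  | succ n hn ih =>
    obtain ⟨hlo, hhi⟩ := ih
    have hpow : (1 : ℝ) / 2 ^ (n + 2) ≤ 1 := by
      rw [div_le_one (by positivity)]
      exact one_le_pow₀ one_le_two
    have hstep : (1 : ℝ) / 2 ^ (n + 1 + 2) = 1 / 2 ^ (n + 2) / 2 := by
      rw [show n + 1 + 2 = n + 2 + 1 by ring, pow_succ, div_div]
    have hsqrt_ge : 2 + 2 / 3 * (q n - 3 / 4) ≤ √(1 + 4 * q n) :=
      Real.le_sqrt_of_sq_le (by nlinarith)
    have hsqrt_le : √(1 + 4 * q n) ≤ 2 + (q n - 3 / 4) :=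
      Real.sqrt_le_iff.mpr ⟨by linarith, by nlinarith⟩
    rw [hqrec n hn, hstep]
    constructor <;> linarith
end

section
/- For every n ≥ 1, ε_{n+1} ≥ (1/2)·ε_n − 2^{−(2n+5)}. -/
theorem sqrt_one_add_four_mul_le {x : ℝ} (hx : 3 / 4 ≤ x) :
    Real.sqrt (1 + 4 * x) ≤ 2 + (x - 3 / 4) :=
  Real.sqrt_le_iff.mpr ⟨by linarith, by nlinarith [sq_nonneg (x - 3 / 4)]⟩

theorem le_sqrt_one_add_four_mul {x : ℝ} (hx : 3 / 4 ≤ x) (hx' : x ≤ 7 / 4) :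
    2 + (x - 3 / 4) - (x - 3 / 4) ^ 2 / 4 ≤ Real.sqrt (1 + 4 * x) := by
  obtain ⟨e, rfl⟩ : ∃ e, x = e + 3 / 4 := ⟨x - 3 / 4, by ring⟩
  have he : 0 ≤ e := by linarith
  apply Real.le_sqrt_of_sq_le
  have h : 0 ≤ e ^ 3 * (8 - e) := mul_nonneg (pow_nonneg he 3) (by linarith)
  linear_combination h / 16

theorem eps_mem_Icc (q : ℕ → ℝ)
    (hq1 : q 1 = (Real.sqrt 45 - 5) / 2)
    (hqrec : ∀ n, 1 ≤ n → q (n + 1) = (3 / 2) * Real.sqrt (1 + 4 * q n) - 3 / 2 - q n)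
    (n : ℕ) (hn : 1 ≤ n) :
    q n - 3 / 4 ∈ Set.Icc 0 ((1 / 4) * (1 / 2 : ℝ) ^ n) := by
  induction n, hn using Nat.le_induction with
  | base =>
    have hl : (13 / 2 : ℝ) ≤ Real.sqrt 45 := Real.le_sqrt_of_sq_le (by norm_num)
    have hu : Real.sqrt 45 ≤ 27 / 4 := Real.sqrt_le_iff.mpr (by norm_num)
    rw [hq1]
    constructor <;> linarith
  | succ n hn ih =>
    obtain ⟨h0, h1⟩ := ih
    have hp : (1 / 2 : ℝ) ^ n ≤ 1 := pow_le_one₀ (by norm_num) (by norm_num)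
    have hu := sqrt_one_add_four_mul_le (x := q n) (by linarith)
    have hl := le_sqrt_one_add_four_mul (x := q n) (by linarith) (by linarith)
    rw [hqrec n hn, pow_succ]
    constructor
    · nlinarith
    · linarith


/-- Let `(q_n)_{n≥1}` be defined by `q 1 = (√45 − 5)/2` and
`q (n+1) = (3/2)·√(1 + 4·q n) − 3/2 − q n`, and let `ε n = q n − 3/4`.
Then for every `n ≥ 1`, `ε (n+1) ≥ (1/2)·ε n − 2^{-(2n+5)}`. -/
theorem eps_lower_recurrence (q : ℕ → ℝ)
    (hq1 : q 1 = (Real.sqrt 45 - 5) / 2)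
    (hqrec : ∀ n, 1 ≤ n → q (n + 1) = (3 / 2) * Real.sqrt (1 + 4 * q n) - 3 / 2 - q n) :
    ∀ n, 1 ≤ n → q (n + 1) - 3 / 4 ≥ (1 / 2) * (q n - 3 / 4) - 1 / 2 ^ (2 * n + 5) := by
  intro n hn
  obtain ⟨h0, h1⟩ := eps_mem_Icc q hq1 hqrec n hn
  have hp : (1 / 2 : ℝ) ^ n ≤ 1 := pow_le_one₀ (by norm_num) (by norm_num)
  have hl := le_sqrt_one_add_four_mul (x := q n) (by linarith) (by linarith)
  have hsq := pow_le_pow_left₀ h0 h1 2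
  have hpow : (1 : ℝ) / 2 ^ (2 * n + 5) = ((1 / 2 : ℝ) ^ n) ^ 2 / 32 := by
    rw [← one_div_pow, pow_add, mul_comm 2 n, pow_mul]
    ring
  rw [hqrec n hn, hpow]
  nlinarith [sq_nonneg ((1 / 2 : ℝ) ^ n)]
end

section
/- For every n ≥ 1, ε_n ≥ 1/(2^{n+5} − 1). -/
/-- One step of the recursion, written for `t = √(1 + ε) - 1`, so that `ε = 2t + t²` is sent
to `t - t²`. -/
lemma one_le_mul_of_step {t A : ℝ} (ht : 0 < t) (ht' : t ≤ 1 / 4)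
    (hA : 1 ≤ (2 * t + t ^ 2) * (A - 2)) : 1 ≤ (t - t ^ 2) * (2 * A - 2) := by
  have hε : 0 < 2 * t + t ^ 2 := by positivity
  have hε' : 0 < t - t ^ 2 := by nlinarith
  have hpoly : 2 * t + t ^ 2 ≤ 2 * (t - t ^ 2) * (1 + (2 * t + t ^ 2)) := by
    have : 0 ≤ t ^ 2 * (1 - 2 * t - 2 * t ^ 2) := mul_nonneg (sq_nonneg t) (by nlinarith)
    linarith
  have hmul := mul_le_mul_of_nonneg_left hA hε'.le
  refine le_of_mul_le_mul_left ?_ hε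
  linarith

/-- Let `(q_n)_{n≥1}` be defined by `q 1 = (√45 − 5)/2` and
`q (n+1) = (3/2)·√(1 + 4·q n) − 3/2 − q n`, and let `ε n = q n − 3/4`.
Then for every `n ≥ 1`, `ε n ≥ 1/(2^{n+5} − 1)`. -/
theorem eps_lower_bound (q : ℕ → ℝ)
    (hq1 : q 1 = (Real.sqrt 45 - 5) / 2)
    (hqrec : ∀ n, 1 ≤ n → q (n + 1) = (3 / 2) * Real.sqrt (1 + 4 * q n) - 3 / 2 - q n) :
    ∀ n, 1 ≤ n → q n - 3 / 4 ≥ 1 / (2 ^ (n + 5) - 1) := by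
  have key : ∀ n, 1 ≤ n → 0 < q n - 3 / 4 ∧ q n - 3 / 4 ≤ 1 / 4 ∧
      1 ≤ (q n - 3 / 4) * (2 ^ (n + 5) - 2) := by
    intro n hn
    induction n, hn using Nat.le_induction with
    | base =>
      have h₁ : (6.7 : ℝ) ≤ Real.sqrt 45 := Real.le_sqrt_of_sq_le (by norm_num)
      have h₂ : Real.sqrt 45 ≤ 7 := Real.sqrt_le_iff.2 (by norm_num)
      rw [hq1]
      norm_num at h₁ ⊢
      refine ⟨?_, ?_, ?_⟩ <;> linarith
    | succ n hn ih =>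
      obtain ⟨hpos, hle, hA⟩ := ih
      obtain ⟨t, ht⟩ : ∃ t, Real.sqrt (1 + 4 * q n) = 2 * (1 + t) :=
        ⟨Real.sqrt (1 + 4 * q n) / 2 - 1, by ring⟩
      have hsq : 1 + 4 * q n = (2 * (1 + t)) ^ 2 := by
        rw [← ht, Real.sq_sqrt (by linarith)]
      have hε : q n - 3 / 4 = 2 * t + t ^ 2 := by linarith
      have hnonneg : 0 ≤ 2 * (1 + t) := ht ▸ Real.sqrt_nonneg _
      rw [hε] at hpos hle hA
      have htpos : 0 < t := by nlinarith
      have htle : t ≤ 1 / 4 := by nlinarith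
      have hε' : q (n + 1) - 3 / 4 = t - t ^ 2 := by
        rw [hqrec n hn, ht]
        linarith
      rw [hε', show (2 : ℝ) ^ (n + 1 + 5) = 2 * 2 ^ (n + 5) by ring]
      exact ⟨by nlinarith, by nlinarith, one_le_mul_of_step htpos htle hA⟩
  intro n hn
  obtain ⟨hpos, -, hA⟩ := key n hn
  have hpow : (1 : ℝ) < 2 ^ (n + 5) := one_lt_pow₀ one_lt_two (by omega)
  rw [ge_iff_le, div_le_iff₀ (by linarith)]
  linarith
end

section
/- For every n ≥ 2, ε_n ≥ ε_1/2^{n−1} − (2^{−(n+5)} + 2^{−(n+6)} + ⋯ + 2^{−(2n+3)}). -/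
/-- A block of the geometric series of ratio `1 / 2`. -/
lemma sum_Ico_one_div_two_pow {a b : ℕ} (h : a ≤ b) :
    ∑ k ∈ Finset.Ico a b, (1 : ℝ) / 2 ^ k = 2 / 2 ^ a - 2 / 2 ^ b := by
  induction b, h using Nat.le_induction with
  | base => simp
  | succ b hab ih =>
    rw [Finset.sum_Ico_succ_top hab, ih, pow_succ]
    field_simp
    ring

lemma two_add_sub_sq_div_four_le_sqrt {e : ℝ} (h0 : 0 ≤ e) (h1 : e ≤ 1) :
    2 + e - e ^ 2 / 4 ≤ √(4 + 4 * e) := by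
  apply Real.le_sqrt_of_sq_le
  nlinarith [mul_nonneg (pow_nonneg h0 3) (sub_nonneg.2 h1), pow_nonneg h0 3]

lemma sqrt_le_two_add {e : ℝ} (h0 : 0 ≤ e) : √(4 + 4 * e) ≤ 2 + e :=
  Real.sqrt_le_iff.2 ⟨by linarith, by nlinarith [sq_nonneg e]⟩

/-- Bounds for a sequence `e` satisfying `e (m + 1) = (3 / 2) √(4 + 4 e m) - 3 - e m` and
`0 ≤ e 0 ≤ 1 / 8`. -/
lemma sqrt_recurrence_bounds {e : ℕ → ℝ} (h0 : 0 ≤ e 0) (h1 : e 0 ≤ 1 / 8)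
    (hrec : ∀ m, e (m + 1) = (3 / 2) * √(4 + 4 * e m) - 3 - e m) (m : ℕ) :
    0 ≤ e m ∧ e m ≤ e 0 * (1 / 2) ^ m ∧
      e 0 * (1 / 2) ^ m - ((1 / 2) ^ m / 32 - ((1 / 2) ^ m) ^ 2 / 32) ≤ e m := by
  induction m with
  | zero => simpa using h0
  | succ m ih =>
    obtain ⟨hpos, hupper, hlower⟩ := ih
    rw [hrec m, pow_succ]
    have hx0 : (0 : ℝ) ≤ (1 / 2) ^ m := by positivity
    have hx1 : ((1 : ℝ) / 2) ^ m ≤ 1 := pow_le_one₀ (by norm_num) (by norm_num)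
    generalize ((1 : ℝ) / 2) ^ m = x at *
    have hx : e m ≤ x / 8 := by nlinarith
    have hsq : e m ^ 2 ≤ (x / 8) ^ 2 := pow_le_pow_left₀ hpos hx 2
    have hsl := two_add_sub_sq_div_four_le_sqrt hpos (by linarith)
    have hsu := sqrt_le_two_add hpos
    refine ⟨?_, by linarith, ?_⟩
    · nlinarith
    · nlinarith [sq_nonneg x]

/-- Let `(q_n)_{n≥1}` be defined by `q 1 = (√45 − 5)/2` and
`q (n+1) = (3/2)·√(1 + 4·q n) − 3/2 − q n`, and let `ε n = q n − 3/4`.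
Then for every `n ≥ 2`, `ε n ≥ ε 1 / 2^{n-1} − (2^{-(n+5)} + ⋯ + 2^{-(2n+3)})`. -/
theorem eps_lower_bound_sum (q : ℕ → ℝ)
    (hq1 : q 1 = (Real.sqrt 45 - 5) / 2)
    (hqrec : ∀ n, 1 ≤ n → q (n + 1) = (3 / 2) * Real.sqrt (1 + 4 * q n) - 3 / 2 - q n) :
    ∀ n, 2 ≤ n →
      q n - 3 / 4 ≥ (q 1 - 3 / 4) / 2 ^ (n - 1) - ∑ k ∈ Finset.Icc (n + 5) (2 * n + 3), (1 : ℝ) / 2 ^ k := by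
  have hsqrt : √45 ≤ 27 / 4 := Real.sqrt_le_iff.2 ⟨by norm_num, by norm_num⟩
  have hsqrt' : 13 / 2 ≤ √45 := Real.le_sqrt_of_sq_le (by norm_num)
  intro n hn
  obtain ⟨m, rfl⟩ : ∃ m, n = m + 1 := ⟨n - 1, by lia⟩
  have hbound := (sqrt_recurrence_bounds (e := fun m ↦ q (m + 1) - 3 / 4)
    (by simp only [zero_add, hq1]; linarith) (by simp only [zero_add, hq1]; linarith)
    (fun m ↦ by
      simp only [hqrec (m + 1) (by lia)]
      rw [show 4 + 4 * (q (m + 1) - 3 / 4) = 1 + 4 * q (m + 1) by ring]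
      ring) m).2.2
  have hsum : ∑ k ∈ Finset.Icc (m + 1 + 5) (2 * (m + 1) + 3), (1 : ℝ) / 2 ^ k =
      (1 / 2) ^ m / 32 - ((1 / 2) ^ m) ^ 2 / 32 := by
    rw [← Finset.Ico_add_one_right_eq_Icc, sum_Ico_one_div_two_pow (by lia),
      show m + 1 + 5 = m + 6 by ring, show 2 * (m + 1) + 3 + 1 = m * 2 + 6 by ring,
      pow_add, pow_add, pow_mul, one_div_pow]
    field_simp
    ring
  rw [hsum, Nat.add_sub_cancel, ge_iff_le, div_eq_mul_one_div, ← one_div_pow]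
  simpa only [zero_add] using hbound
end

section
/- The sequence (q_n)_{n≥1} is strictly decreasing and converges to 3/4. -/
/-- One step of the recursion at least halves the (positive) distance to the fixed point `3/4`. -/
lemma recursion_step_mem_Ioc {x : ℝ} (hx : 3 / 4 < x) (hx' : x < 15 / 4) :
    (3 / 2) * √(1 + 4 * x) - 3 / 2 - x - 3 / 4 ∈ Set.Ioc 0 ((x - 3 / 4) / 2) := by
  have hsq : √(1 + 4 * x) ^ 2 = 1 + 4 * x := Real.sq_sqrt (by linarith)
  have h2 : 2 < √(1 + 4 * x) := Real.lt_sqrt_of_sq_lt (by linarith)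
  have h4 : √(1 + 4 * x) < 4 := (Real.sqrt_lt' (by norm_num)).2 (by linarith)
  constructor <;> nlinarith

/-- Let `(q_n)_{n≥1}` be defined by `q 1 = (√45 − 5)/2` and
`q (n+1) = (3/2)·√(1 + 4·q n) − 3/2 − q n`.
Then `(q_n)_{n≥1}` is strictly decreasing and converges to `3/4`. -/
theorem q_strict_decreasing_tendsto (q : ℕ → ℝ)
    (hq1 : q 1 = (Real.sqrt 45 - 5) / 2)
    (hqrec : ∀ n, 1 ≤ n → q (n + 1) = (3 / 2) * Real.sqrt (1 + 4 * q n) - 3 / 2 - q n) :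
    (∀ n, 1 ≤ n → q (n + 1) < q n) ∧
      Filter.Tendsto q Filter.atTop (nhds (3 / 4)) := by
  have h1 : q 1 - 3 / 4 ∈ Set.Ioc (0 : ℝ) 1 := by
    have hlo : (13 / 2 : ℝ) < √45 := Real.lt_sqrt_of_sq_lt (by norm_num)
    have hhi : √45 < (7 : ℝ) := (Real.sqrt_lt' (by norm_num)).2 (by norm_num)
    rw [hq1]
    constructor <;> linarith
  have hbound : ∀ n, q (n + 1) - 3 / 4 ∈ Set.Ioc (0 : ℝ) ((1 / 2) ^ n) := by
    intro n
    induction n with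
    | zero => simpa using h1
    | succ n ih =>
      have hle : (1 / 2 : ℝ) ^ n ≤ 1 := pow_le_one₀ (by norm_num) (by norm_num)
      obtain ⟨hpos, hhalf⟩ :=
        recursion_step_mem_Ioc (x := q (n + 1)) (by linarith [ih.1]) (by linarith [ih.2])
      rw [hqrec (n + 1) (by omega)]
      refine ⟨hpos, hhalf.trans ?_⟩
      rw [pow_succ]
      linarith [ih.2]
  constructor
  · intro n hn
    obtain ⟨m, rfl⟩ := Nat.exists_eq_add_of_le' hn
    have hle : (1 / 2 : ℝ) ^ m ≤ 1 := pow_le_one₀ (by norm_num) (by norm_num)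
    obtain ⟨hpos, hm⟩ := hbound m
    have hhalf := (recursion_step_mem_Ioc (x := q (m + 1)) (by linarith) (by linarith)).2
    rw [hqrec (m + 1) hn]
    linarith
  · rw [← Filter.tendsto_add_atTop_iff_nat 1, ← tendsto_sub_nhds_zero_iff]
    exact squeeze_zero (fun n => (hbound n).1.le) (fun n => (hbound n).2)
      (tendsto_pow_atTop_nhds_zero_of_lt_one (by norm_num) (by norm_num))
end

section
/- For every n ≥ 1, q_{n+1}/q_n ≤ 1 − 2^{−(n+6)}. -/
/-- With `1 + 4 * x = (2 + d) ^ 2`, the excess of `x` over `3/4` is `d + d ^ 2 / 4`. -/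
lemma exists_sqrt_eq_two_add {x : ℝ} (hx : 0 < x - 3 / 4) (hx' : x - 3 / 4 ≤ 11 / 100) :
    ∃ d, 0 < d ∧ d ≤ 11 / 100 ∧ x = 3 / 4 + d + d ^ 2 / 4 ∧ √(1 + 4 * x) = 2 + d := by
  have hs : √(1 + 4 * x) ^ 2 = 1 + 4 * x := Real.sq_sqrt (by linarith)
  have h2 : 2 < √(1 + 4 * x) := Real.lt_sqrt_of_sq_lt (by linarith)
  exact ⟨√(1 + 4 * x) - 2, by linarith, by nlinarith, by linarith, by ring⟩

lemma q_excess_bounds (q : ℕ → ℝ)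
    (hq1 : q 1 = (Real.sqrt 45 - 5) / 2)
    (hqrec : ∀ n, 1 ≤ n → q (n + 1) = (3 / 2) * Real.sqrt (1 + 4 * q n) - 3 / 2 - q n)
    {n : ℕ} (hn : 1 ≤ n) :
    0 < q n - 3 / 4 ∧ q n - 3 / 4 ≤ 11 / 100 ∧ 1 ≤ (q n - 3 / 4) * (6 * 2 ^ n - 2) := by
  induction n, hn using Nat.le_induction with
  | base =>
    have h₁ : 67 / 10 < √45 := Real.lt_sqrt_of_sq_lt (by norm_num)
    have h₂ : √45 < 672 / 100 := (Real.sqrt_lt' (by norm_num)).2 (by norm_num)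
    rw [hq1]
    refine ⟨by linarith, by linarith, by linarith⟩
  | succ n hn ih =>
    obtain ⟨hpos, hle, hlow⟩ := ih
    obtain ⟨d, hd, hd', hq, hs⟩ := exists_sqrt_eq_two_add hpos hle
    have he : q n - 3 / 4 = d + d ^ 2 / 4 := by linarith
    have he' : q (n + 1) - 3 / 4 = d / 2 - d ^ 2 / 4 := by
      rw [hqrec n hn, hs, hq]; ring
    rw [he] at hpos hlow
    rw [he', pow_succ (2 : ℝ) n]
    have hpos' : 0 < d / 2 - d ^ 2 / 4 := by nlinarith
    refine ⟨hpos', by nlinarith, ?_⟩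
    have hstep : d + d ^ 2 / 4 ≤ (d / 2 - d ^ 2 / 4) * (2 + 2 * (d + d ^ 2 / 4)) := by
      have h : 0 ≤ d ^ 2 * (1 / 4 - d / 4 - d ^ 2 / 8) :=
        mul_nonneg (sq_nonneg d) (by nlinarith)
      linarith
    refine le_of_mul_le_mul_left ?_ hpos
    linarith [mul_le_mul_of_nonneg_left hlow hpos'.le]

/-- Let `(q_n)_{n≥1}` be defined by `q 1 = (√45 − 5)/2` and
`q (n+1) = (3/2)·√(1 + 4·q n) − 3/2 − q n`.
Then for every `n ≥ 1`, `q (n+1) / q n ≤ 1 − 2^{-(n+6)}`. -/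
theorem q_ratio_bound (q : ℕ → ℝ)
    (hq1 : q 1 = (Real.sqrt 45 - 5) / 2)
    (hqrec : ∀ n, 1 ≤ n → q (n + 1) = (3 / 2) * Real.sqrt (1 + 4 * q n) - 3 / 2 - q n) :
    ∀ n, 1 ≤ n → q (n + 1) / q n ≤ 1 - 1 / 2 ^ (n + 6) := by
  intro n hn
  obtain ⟨hpos, hle, hlow⟩ := q_excess_bounds q hq1 hqrec hn
  obtain ⟨d, hd, hd', hq, hs⟩ := exists_sqrt_eq_two_add hpos hle
  have hX : (0 : ℝ) < 2 ^ n := by positivity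
  have hdX : 1 ≤ d * (8 * 2 ^ n) := by
    have : q n - 3 / 4 ≤ 11 / 10 * d := by nlinarith
    nlinarith [mul_le_mul_of_nonneg_right this hX.le, mul_pos hd hX]
  have hinv : (1 : ℝ) / 2 ^ (n + 6) ≤ d / 8 := by
    rw [div_le_iff₀ (by positivity), pow_add]
    linarith
  have hqpos : 0 < q n := by linarith
  have hratio : q (n + 1) ≤ (1 - d / 8) * q n := by
    rw [hqrec n hn, hs, hq]
    nlinarith [mul_pos hd hd, pow_pos hd 3]
  calc q (n + 1) / q n ≤ 1 - d / 8 := (div_le_iff₀ hqpos).2 hratio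
    _ ≤ 1 - 1 / 2 ^ (n + 6) := by linarith
end

section
/- For every n ≥ 1, (2·(q_{n+1}/q_n) − 1)^{2^n} ≤ e^{−1/32} < 1. -/
/-- With `ε = q - 3/4` and `t = √(1 + ε) - 1`, one step of the recursion sends
`ε = 2 t + t ^ 2` to `t - t ^ 2`. -/
lemma exists_param_of_recursion {a : ℝ} (ha : 3 / 4 ≤ a) :
    ∃ t : ℝ, 0 ≤ t ∧ a - 3 / 4 = 2 * t + t ^ 2 ∧
      (3 / 2) * Real.sqrt (1 + 4 * a) - 3 / 2 - a - 3 / 4 = t - t ^ 2 := by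
  have hs := Real.sq_sqrt (show 0 ≤ 1 + 4 * a by linarith)
  have h2 : 2 ≤ Real.sqrt (1 + 4 * a) := Real.le_sqrt_of_sq_le (by linarith)
  exact ⟨Real.sqrt (1 + 4 * a) / 2 - 1, by linarith, by linarith, by linarith⟩

/-- The error `q n - 3/4` is of exact order `2⁻ⁿ`, with explicit constants. -/
lemma q_error_bounds (q : ℕ → ℝ)
    (hq1 : q 1 = (Real.sqrt 45 - 5) / 2)
    (hqrec : ∀ n, 1 ≤ n → q (n + 1) = (3 / 2) * Real.sqrt (1 + 4 * q n) - 3 / 2 - q n)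
    (n : ℕ) (hn : 1 ≤ n) :
    1 / 10 * (1 / 2) ^ n + 1 / 5 * ((1 / 2) ^ n) ^ 2 ≤ q n - 3 / 4 ∧
      q n - 3 / 4 ≤ 21 / 100 * (1 / 2) ^ n := by
  induction n, hn using Nat.le_induction with
  | base =>
    have hl : (6.705 : ℝ) ≤ Real.sqrt 45 := Real.le_sqrt_of_sq_le (by norm_num)
    have hu : Real.sqrt 45 ≤ 6.71 := Real.sqrt_le_iff.mpr (by norm_num)
    rw [hq1]
    constructor <;> linarith
  | succ n hn ih =>
    obtain ⟨hl, hu⟩ := ih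
    have hx : (0 : ℝ) < (1 / 2) ^ n := by positivity
    rw [pow_succ]
    generalize ((1 : ℝ) / 2) ^ n = x at *
    obtain ⟨t, ht, he, he'⟩ := exists_param_of_recursion (a := q n) (by nlinarith)
    rw [← hqrec n hn] at he'
    have hsq : (q n - 3 / 4) ^ 2 ≤ (21 / 100 * x) ^ 2 :=
      pow_le_pow_left₀ (by nlinarith) hu 2
    have hstep : (q n - 3 / 4) / 2 - 3 / 8 * (q n - 3 / 4) ^ 2 ≤ q (n + 1) - 3 / 4 := by
      rw [he', he]
      nlinarith [pow_nonneg ht 3, pow_nonneg ht 4]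
    constructor <;> nlinarith

/-- Let `(q_n)_{n≥1}` be defined by `q 1 = (√45 − 5)/2` and
`q (n+1) = (3/2)·√(1 + 4·q n) − 3/2 − q n`.
Then for every `n ≥ 1`, `(2·(q (n+1)/q n) − 1)^(2^n) ≤ e^{-1/32} < 1`. -/
theorem q_ratio_power_bound (q : ℕ → ℝ)
    (hq1 : q 1 = (Real.sqrt 45 - 5) / 2)
    (hqrec : ∀ n, 1 ≤ n → q (n + 1) = (3 / 2) * Real.sqrt (1 + 4 * q n) - 3 / 2 - q n) :
    ∀ n, 1 ≤ n →
      (2 * (q (n + 1) / q n) - 1) ^ (2 ^ n) ≤ Real.exp (-(1 / 32)) ∧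
        Real.exp (-(1 / 32)) < 1 := by
  intro n hn
  refine ⟨?_, Real.exp_lt_one_iff.mpr (by norm_num)⟩
  obtain ⟨hl, hu⟩ := q_error_bounds q hq1 hqrec n hn
  have hx : (0 : ℝ) < (1 / 2) ^ n := by positivity
  have hx' : ((1 : ℝ) / 2) ^ n ≤ 1 / 2 := pow_le_of_le_one (by norm_num) (by norm_num) (by lia)
  have hx2 : (2 : ℝ) ^ n * (1 / 2) ^ n = 1 := by rw [← mul_pow]; norm_num
  have hq : 3 / 4 ≤ q n := by nlinarith
  have hq0 : 0 < q n := by linarith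
  obtain ⟨t, ht, he, he'⟩ := exists_param_of_recursion hq
  rw [← hqrec n hn] at he'
  have hnonneg : 0 ≤ 2 * (q (n + 1) / q n) - 1 := by
    have : 1 / 2 ≤ q (n + 1) / q n := by
      rw [le_div_iff₀ hq0]
      nlinarith
    linarith
  have hle : 2 * (q (n + 1) / q n) - 1 ≤ 1 - 1 / 32 * (1 / 2) ^ n := by
    have : q (n + 1) / q n ≤ 1 - 1 / 64 * (1 / 2) ^ n := by
      rw [div_le_iff₀ hq0]
      nlinarith
    linarith
  calc (2 * (q (n + 1) / q n) - 1) ^ (2 ^ n)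
      ≤ Real.exp (-(1 / 32 * (1 / 2) ^ n)) ^ (2 ^ n) :=
        pow_le_pow_left₀ hnonneg (hle.trans (Real.one_sub_le_exp_neg _)) _
    _ = Real.exp (-(1 / 32)) := by
        rw [← Real.exp_nat_mul]
        congr 1
        push_cast
        linear_combination (-(1 / 32)) * hx2
end

section
/- Define Φ : {0,1,2}^ω × {0,1}^ω → {0,1}^ω recursively as follows: having defined σ = Φ(x,y)↾n (a node of T_x with [σ] ∩ [T_x] ≠ ∅), set Φ(x,y)(n) = 0 if σ1 ∉ T_x, set Φ(x,y)(n) = 1 if σ0 ∉ T_x, and set Φ(x,y)(n) = y(n) if both σ0 and σ1 belong to T_x. Then: (i) Φ is total and continuous; (ii) Φ(x,y) ∈ [T_x] for every pair (x,y); and (iii) the pushforward of the product measure λ₃ ⊗ λ₂ under Φ is λ₂. -/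
open MeasureTheory
open scoped ENNReal

/-- Value of a binary string read as a binary numeral (most significant bit first). -/
def strVal (σ : List Bool) : ℕ := σ.foldl (fun n b => 2 * n + b.toNat) 0

/-- Index of a binary string in the length-lexicographic enumeration of `{0,1}^{<ω}`,
so that `strIdx (strAt n) = n`. -/
def strIdx (σ : List Bool) : ℕ := 2 ^ σ.length + strVal σ - 1

/-- The `n`-th binary string `σ_n` in the length-lexicographic enumeration
(`strAt 0` is the empty string). -/
def strAt : ℕ → List Bool
  | 0 => []
  | n + 1 => strAt (n / 2) ++ [decide (n % 2 = 1)]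
decreasing_by omega

/-- The initial segment `z↾n` of an infinite binary sequence, as a list. -/
def initSeg (z : ℕ → Bool) (n : ℕ) : List Bool := (List.range n).map z

/-- The basic cylinder `[σ]` of all infinite binary sequences extending `σ`. -/
def cyl (σ : List Bool) : Set (ℕ → Bool) := {z | initSeg z σ.length = σ}

/-- Auxiliary function for the generic tree coding: for `m < N`, `treeAux allow N m` decides
whether the `m`-th binary string (in length-lexicographic order) belongs to the tree
determined by the rule `allow`, where the empty string always belongs to the tree and, for
the `(i+1)`-st element `σ` of the tree (in length-lexicographic order), the child `σ⌢b`
belongs to the tree iff `allow i b`. -/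
def treeAux (allow : ℕ → Bool → Bool) : ℕ → ℕ → Bool
  | 0, _ => true
  | N + 1, m =>
    if m < N then treeAux allow N m
    else if N = 0 then true
    else
      let σ := strAt N
      let p := strIdx σ.dropLast
      if treeAux allow N p then
        allow ((Finset.range p).filter (fun j => treeAux allow N j = true)).card σ.getLast!
      else false

/-- Membership in the tree determined by the branching rule `allow`. -/
def memTree (allow : ℕ → Bool → Bool) (σ : List Bool) : Bool :=
  treeAux allow (strIdx σ + 1) (strIdx σ)

/-- The tree `T_x ⊆ {0,1}^{<ω}` coded by `x ∈ {0,1,2}^ω`: the empty string is in `T_x`, and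
if `σ` is the `(i+1)`-st element of `T_x` in length-lexicographic order then `x i = 0` keeps
only the left child `σ0`, `x i = 1` keeps only the right child `σ1`, and `x i = 2` keeps
both children. -/
def memT (x : ℕ → Fin 3) : List Bool → Bool :=
  memTree (fun i b => decide (x i = 2 ∨ (x i = 0 ∧ b = false) ∨ (x i = 1 ∧ b = true)))

/-- The finite approximation of length `n` of `Φ(x,y)`: follow `y` through the tree `T_x`,
using `y` to decide which way to go at branching nodes. -/
def phiList (x : ℕ → Fin 3) (y : ℕ → Bool) : ℕ → List Bool
  | 0 => []
  | n + 1 =>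
    let σ := phiList x y n
    σ ++ [if memT x (σ ++ [true]) = false then false
          else if memT x (σ ++ [false]) = false then true
          else y n]

/-- The map `Φ : {0,1,2}^ω × {0,1}^ω → {0,1}^ω`: `Φ(x,y)(n) = 0` if `σ1 ∉ T_x`,
`Φ(x,y)(n) = 1` if `σ0 ∉ T_x`, and `Φ(x,y)(n) = y n` if both `σ0, σ1 ∈ T_x`, where
`σ = Φ(x,y)↾n`. -/
def PhiMap (x : ℕ → Fin 3) (y : ℕ → Bool) (n : ℕ) : Bool := (phiList x y (n + 1)).getLast!

/-- Membership of the `m`-th binary string in the tree determined by `allow`. -/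
def nodeMem (allow : ℕ → Bool → Bool) (m : ℕ) : Bool := treeAux allow (m + 1) m

/-- The number of tree nodes preceding the `m`-th binary string. -/
def nodeRank (allow : ℕ → Bool → Bool) (m : ℕ) : ℕ :=
  ((Finset.range m).filter (fun j => nodeMem allow j = true)).card

/-- The branching rule of `T_x`. -/
def ternaryRule (x : ℕ → Fin 3) (i : ℕ) (b : Bool) : Bool :=
  decide (x i = 2 ∨ (x i = 0 ∧ b = false) ∨ (x i = 1 ∧ b = true))

theorem strIdx_append (σ : List Bool) (b : Bool) :
    strIdx (σ ++ [b]) = 2 * strIdx σ + b.toNat + 1 := by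
  have := Nat.one_le_two_pow (n := σ.length)
  simp only [strIdx, strVal, List.length_append, List.length_singleton, List.foldl_append,
    List.foldl_cons, List.foldl_nil, pow_succ]
  omega

theorem strIdx_strAt (n : ℕ) : strIdx (strAt n) = n := by
  induction n using Nat.strong_induction_on with
  | _ n ih =>
    cases n with
    | zero => simp [strAt, strIdx, strVal]
    | succ n =>
      rw [strAt, strIdx_append, ih (n / 2) (by omega)]
      rcases Nat.mod_two_eq_zero_or_one n with h | h <;> simp [h] <;> omega

theorem treeAux_eq_nodeMem (allow : ℕ → Bool → Bool) {N m : ℕ} (h : m < N) :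
    treeAux allow N m = nodeMem allow m := by
  induction N with
  | zero => omega
  | succ N ih =>
    rcases Nat.lt_succ_iff_lt_or_eq.mp h with h' | rfl
    · rw [treeAux, if_pos h', ih h']
    · rfl

theorem nodeMem_zero (allow : ℕ → Bool → Bool) : nodeMem allow 0 = true := by
  simp [nodeMem, treeAux]

theorem nodeMem_succ (allow : ℕ → Bool → Bool) (n : ℕ) :
    nodeMem allow (n + 1) =
      (nodeMem allow (n / 2) && allow (nodeRank allow (n / 2)) (decide (n % 2 = 1))) := by
  have hp : n / 2 < n + 1 := by omega
  have hcard : (Finset.range (n / 2)).filter (fun j => treeAux allow (n + 1) j = true) =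
      (Finset.range (n / 2)).filter (fun j => nodeMem allow j = true) := by
    refine Finset.filter_congr fun j hj => ?_
    rw [treeAux_eq_nodeMem allow (by have := Finset.mem_range.mp hj; omega)]
  rw [nodeMem, treeAux, if_neg (lt_irrefl _), if_neg (Nat.succ_ne_zero n)]
  simp only [strAt, List.dropLast_concat, strIdx_strAt, hcard, treeAux_eq_nodeMem allow hp]
  cases nodeMem allow (n / 2) <;> simp [nodeRank, List.getLast!_eq_getLast?_getD]

theorem nodeRank_lt (allow : ℕ → Bool → Bool) {p m : ℕ} (h : p < m)
    (hp : nodeMem allow p = true) : nodeRank allow p < nodeRank allow m := by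
  refine Finset.card_lt_card ⟨Finset.filter_subset_filter _
    (Finset.range_subset_range.mpr h.le), fun hs => ?_⟩
  have := hs (Finset.mem_filter.mpr ⟨Finset.mem_range.mpr h, hp⟩)
  simp at this

theorem nodeMem_congr {allow allow' : ℕ → Bool → Bool} {m : ℕ}
    (h : ∀ i < nodeRank allow m, allow i = allow' i) (j : ℕ) (hj : j ≤ m) :
    nodeMem allow j = nodeMem allow' j := by
  induction j using Nat.strong_induction_on with
  | _ j ih =>
    cases j with
    | zero => rw [nodeMem_zero, nodeMem_zero]
    | succ n =>
      have hr : nodeRank allow (n / 2) = nodeRank allow' (n / 2) := by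
        refine congrArg Finset.card (Finset.filter_congr fun k hk => ?_)
        have := Finset.mem_range.mp hk
        rw [ih k (by omega) (by omega)]
      have hp := ih (n / 2) (by omega) (by omega)
      rw [nodeMem_succ, nodeMem_succ, ← hp, ← hr]
      cases hm : nodeMem allow (n / 2) with
      | false => rfl
      | true => rw [h _ (nodeRank_lt allow (by omega) hm)]

theorem nodeRank_congr {allow allow' : ℕ → Bool → Bool} {m : ℕ}
    (h : ∀ i < nodeRank allow m, allow i = allow' i) :
    nodeRank allow m = nodeRank allow' m := by
  refine congrArg Finset.card (Finset.filter_congr fun k hk => ?_)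
  rw [nodeMem_congr h k (Finset.mem_range.mp hk).le]

theorem memT_eq_nodeMem (x : ℕ → Fin 3) (σ : List Bool) :
    memT x σ = nodeMem (ternaryRule x) (strIdx σ) := rfl

theorem memT_append (x : ℕ → Fin 3) (σ : List Bool) (b : Bool) :
    memT x (σ ++ [b]) =
      (memT x σ && ternaryRule x (nodeRank (ternaryRule x) (strIdx σ)) b) := by
  have h1 : (2 * strIdx σ + b.toNat) / 2 = strIdx σ := by cases b <;> simp; omega
  have h2 : decide ((2 * strIdx σ + b.toNat) % 2 = 1) = b := by cases b <;> simp
  rw [memT_eq_nodeMem, strIdx_append, nodeMem_succ, h1, h2, memT_eq_nodeMem]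

/-- The next step of a path through `T_x` from a node of rank `r`, using the digit `c = x r`
and the choice `b` at branching nodes. -/
def stepBit (c : Fin 3) (b : Bool) : Bool :=
  if c = 0 then false else if c = 1 then true else b

theorem stepBit_swap (c : Fin 3) (b : Bool) :
    stepBit (Equiv.swap 0 1 c) (!b) = !stepBit c b := by
  revert c b; decide

theorem ternaryRule_stepBit (x : ℕ → Fin 3) (i : ℕ) (b : Bool) :
    ternaryRule x i (stepBit (x i) b) = true := by
  unfold ternaryRule stepBit
  generalize x i = c
  revert c b; decide

/-- The rank in `T_x` of the node `Φ(x,y)↾n`. -/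
def pathRank (x : ℕ → Fin 3) (y : ℕ → Bool) (n : ℕ) : ℕ :=
  nodeRank (ternaryRule x) (strIdx (phiList x y n))

theorem phiList_succ_of_memT {x : ℕ → Fin 3} {y : ℕ → Bool} {n : ℕ}
    (h : memT x (phiList x y n) = true) :
    phiList x y (n + 1) = phiList x y n ++ [stepBit (x (pathRank x y n)) (y n)] := by
  simp only [phiList, memT_append, h, Bool.true_and, ternaryRule, pathRank]
  generalize x _ = c
  generalize y n = b
  congr 2
  revert c b; decide

theorem memT_phiList (x : ℕ → Fin 3) (y : ℕ → Bool) (n : ℕ) :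
    memT x (phiList x y n) = true := by
  induction n with
  | zero => exact nodeMem_zero _
  | succ n ih =>
    rw [phiList_succ_of_memT ih, memT_append, ih, Bool.true_and]
    exact ternaryRule_stepBit _ _ _

theorem phiList_succ (x : ℕ → Fin 3) (y : ℕ → Bool) (n : ℕ) :
    phiList x y (n + 1) = phiList x y n ++ [stepBit (x (pathRank x y n)) (y n)] :=
  phiList_succ_of_memT (memT_phiList x y n)

theorem PhiMap_eq (x : ℕ → Fin 3) (y : ℕ → Bool) (n : ℕ) :
    PhiMap x y n = stepBit (x (pathRank x y n)) (y n) := by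
  simp [PhiMap, phiList_succ, List.getLast!_eq_getLast?_getD]

theorem initSeg_PhiMap (x : ℕ → Fin 3) (y : ℕ → Bool) (n : ℕ) :
    initSeg (PhiMap x y) n = phiList x y n := by
  induction n with
  | zero => rfl
  | succ n ih =>
    rw [phiList_succ, ← PhiMap_eq, ← ih]
    simp [initSeg, List.range_succ]

theorem pathRank_lt_succ (x : ℕ → Fin 3) (y : ℕ → Bool) (n : ℕ) :
    pathRank x y n < pathRank x y (n + 1) := by
  refine nodeRank_lt _ ?_ (memT_phiList x y n)
  rw [phiList_succ, strIdx_append]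
  omega

theorem pathRank_congr {x x' : ℕ → Fin 3} {y y' : ℕ → Bool} {n : ℕ}
    (hx : ∀ i < pathRank x y n, x i = x' i) (hy : ∀ i < n, y i = y' i) :
    phiList x y n = phiList x' y' n ∧ pathRank x y n = pathRank x' y' n := by
  have hlist : phiList x y n = phiList x' y' n := by
    induction n with
    | zero => rfl
    | succ n ih =>
      have hlt := pathRank_lt_succ x y n
      have hx' : ∀ i < pathRank x y n, x i = x' i := fun i hi => hx i (hi.trans hlt)
      have hl := ih hx' fun i hi => hy i (by omega)
      have hr : pathRank x y n = pathRank x' y' n := by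
        unfold pathRank
        rw [← hl]
        exact nodeRank_congr fun i hi => by unfold ternaryRule; rw [hx' i hi]
      rw [phiList_succ, phiList_succ, ← hr, ← hl, hx _ hlt, hy n (by omega)]
  refine ⟨hlist, ?_⟩
  unfold pathRank
  rw [← hlist]
  exact nodeRank_congr fun i hi => by unfold ternaryRule; rw [hx i hi]

theorem PhiMap_congr {x x' : ℕ → Fin 3} {y y' : ℕ → Bool} {n : ℕ}
    (hx : ∀ i < pathRank x y n, x i = x' i) (hy : ∀ i < n, y i = y' i) {i : ℕ} (hi : i < n) :
    PhiMap x y i = PhiMap x' y' i := by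
  have h := (pathRank_congr hx hy).1
  rw [← initSeg_PhiMap, ← initSeg_PhiMap] at h
  exact List.map_inj_left.mp h i (List.mem_range.mpr hi)

theorem eventually_agree {α β : Type*} [TopologicalSpace α] [DiscreteTopology α]
    [TopologicalSpace β] [DiscreteTopology β] (p : (ℕ → α) × (ℕ → β)) (m n : ℕ) :
    ∀ᶠ q in nhds p, (∀ i < m, p.1 i = q.1 i) ∧ ∀ i < n, p.2 i = q.2 i := by
  have ho := ((PiNat.isOpen_cylinder (fun _ : ℕ => α) p.1 m).preimage continuous_fst).inter
    ((PiNat.isOpen_cylinder (fun _ : ℕ => β) p.2 n).preimage continuous_snd)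
  filter_upwards [ho.mem_nhds ⟨PiNat.self_mem_cylinder p.1 m, PiNat.self_mem_cylinder p.2 n⟩]
    with q hq
  exact ⟨fun i hi => (hq.1 i hi).symm, fun i hi => (hq.2 i hi).symm⟩

theorem continuous_PhiMap :
    Continuous (fun p : (ℕ → Fin 3) × (ℕ → Bool) => PhiMap p.1 p.2) := by
  refine continuous_pi fun n => continuous_iff_continuousAt.mpr fun p => ?_
  refine (continuousAt_const (y := PhiMap p.1 p.2 n)).congr ?_
  filter_upwards [eventually_agree p (pathRank p.1 p.2 (n + 1)) (n + 1)] with q hq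
  exact PhiMap_congr hq.1 hq.2 n.lt_succ_self

theorem continuous_pathRank (n : ℕ) :
    Continuous (fun p : (ℕ → Fin 3) × (ℕ → Bool) => pathRank p.1 p.2 n) := by
  refine continuous_iff_continuousAt.mpr fun p => ?_
  refine (continuousAt_const (y := pathRank p.1 p.2 n)).congr ?_
  filter_upwards [eventually_agree p (pathRank p.1 p.2 n) n] with q hq
  exact (pathRank_congr hq.1 hq.2).2

section Cylinders

variable {α : Type*} [TopologicalSpace α] [DiscreteTopology α] [Countable α]
  [MeasurableSpace α] [BorelSpace α]

theorem measure_ext_of_cylinder {μ ν : Measure (ℕ → α)} [IsProbabilityMeasure μ]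
    [IsProbabilityMeasure ν]
    (h : ∀ (n : ℕ) (w : ℕ → α), μ {x | ∀ i < n, x i = w i} = ν {x | ∀ i < n, x i = w i}) :
    μ = ν := by
  refine ext_of_generate_finite
    {s : Set (ℕ → α) | ∃ (x : ℕ → α) (n : ℕ), s = PiNat.cylinder x n} ?_ ?_ ?_ (by simp)
  · rw [BorelSpace.measurable_eq (α := ℕ → α)]
    exact (PiNat.isTopologicalBasis_cylinders (fun _ : ℕ => α)).borel_eq_generateFrom
  · rintro _ ⟨x, m, rfl⟩ _ ⟨y, n, rfl⟩ ⟨z, hzx, hzy⟩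
    refine ⟨z, max m n, ?_⟩
    ext t
    simp only [Set.mem_inter_iff, PiNat.mem_cylinder_iff] at *
    constructor
    · rintro ⟨h1, h2⟩ i hi
      rcases lt_max_iff.mp hi with hi | hi
      · rw [h1 i hi, hzx i hi]
      · rw [h2 i hi, hzy i hi]
    · intro ht
      exact ⟨fun i hi => by rw [ht i (lt_max_of_lt_left hi), hzx i hi],
        fun i hi => by rw [ht i (lt_max_of_lt_right hi), hzy i hi]⟩
  · rintro _ ⟨x, n, rfl⟩
    exact h n x

theorem measurePreserving_perm {μ : Measure (ℕ → α)} [IsProbabilityMeasure μ] {c : ℕ → ℝ≥0∞}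
    (h : ∀ (n : ℕ) (w : ℕ → α), μ {x | ∀ i < n, x i = w i} = c n) (g : ℕ → Equiv.Perm α) :
    MeasurePreserving (fun (x : ℕ → α) i => g i (x i)) μ μ := by
  have hc : Continuous (fun (x : ℕ → α) i => g i (x i)) :=
    continuous_pi fun i => continuous_of_discreteTopology.comp (continuous_apply i)
  have := Measure.isProbabilityMeasure_map (μ := μ) hc.measurable.aemeasurable
  refine ⟨hc.measurable, measure_ext_of_cylinder fun n w => ?_⟩
  have ho : MeasurableSet {x : ℕ → α | ∀ i < n, x i = w i} :=
    (PiNat.isOpen_cylinder (fun _ : ℕ => α) w n).measurableSet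
  rw [Measure.map_apply hc.measurable ho, h n w, ← h n fun i => (g i).symm (w i)]
  simp only [Set.preimage_ofPred_eq, Equiv.eq_symm_apply]

end Cylinders

/-- Exchange the digits `0` and `1` at position `r`. -/
def swapAt (r i : ℕ) : Equiv.Perm (Fin 3) := if i = r then Equiv.swap 0 1 else 1

/-- Flip the bit at position `n`. -/
def flipAt (n i : ℕ) : Equiv.Perm Bool := if i = n then Equiv.boolNot else 1

theorem pathRank_swapAt {x : ℕ → Fin 3} {y : ℕ → Bool} {n r : ℕ} (h : pathRank x y n ≤ r) :
    pathRank (fun i => swapAt r i (x i)) (fun i => flipAt n i (y i)) n = pathRank x y n ∧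
      ∀ i < n, PhiMap (fun i => swapAt r i (x i)) (fun i => flipAt n i (y i)) i =
        PhiMap x y i := by
  have hx : ∀ i < pathRank x y n, x i = swapAt r i (x i) := fun i hi => by
    simp [swapAt, (hi.trans_le h).ne]
  have hy : ∀ i < n, y i = flipAt n i (y i) := fun i hi => by simp [flipAt, hi.ne]
  exact ⟨(pathRank_congr hx hy).2.symm, fun i hi => (PhiMap_congr hx hy hi).symm⟩

theorem PhiMap_swapAt {x : ℕ → Fin 3} {y : ℕ → Bool} {n r : ℕ} (h : pathRank x y n = r) :
    PhiMap (fun i => swapAt r i (x i)) (fun i => flipAt n i (y i)) n = !PhiMap x y n := by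
  rw [PhiMap_eq, (pathRank_swapAt h.le).1, h, PhiMap_eq, h, ← stepBit_swap]
  simp [swapAt, flipAt]

theorem measurePreserving_swapAt_flipAt {μ3 : Measure (ℕ → Fin 3)} {μ2 : Measure (ℕ → Bool)}
    [IsProbabilityMeasure μ3] [IsProbabilityMeasure μ2]
    (h3 : ∀ (n : ℕ) (w : ℕ → Fin 3), μ3 {x | ∀ i < n, x i = w i} = (1 / 3 : ℝ≥0∞) ^ n)
    (h2 : ∀ (n : ℕ) (w : ℕ → Bool), μ2 {y | ∀ i < n, y i = w i} = (1 / 2 : ℝ≥0∞) ^ n)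
    (r n : ℕ) :
    MeasurePreserving (fun p : (ℕ → Fin 3) × (ℕ → Bool) =>
      ((fun i => swapAt r i (p.1 i), fun i => flipAt n i (p.2 i)) : (ℕ → Fin 3) × (ℕ → Bool)))
      (μ3.prod μ2) (μ3.prod μ2) :=
  (measurePreserving_perm h3 (swapAt r)).prod (measurePreserving_perm h2 (flipAt n))

theorem measurableSet_PhiMap_cylinder (n : ℕ) (w : ℕ → Bool) :
    MeasurableSet {p : (ℕ → Fin 3) × (ℕ → Bool) | ∀ i < n, PhiMap p.1 p.2 i = w i} :=
  continuous_PhiMap.measurable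
    (PiNat.isOpen_cylinder (fun _ : ℕ => Bool) w n).measurableSet

theorem measurableSet_PhiMap_eq (n : ℕ) (b : Bool) :
    MeasurableSet {p : (ℕ → Fin 3) × (ℕ → Bool) | PhiMap p.1 p.2 n = b} :=
  ((measurable_pi_apply n).comp continuous_PhiMap.measurable) (measurableSet_singleton b)

theorem measure_PhiMap_bit_flip {μ3 : Measure (ℕ → Fin 3)} {μ2 : Measure (ℕ → Bool)}
    [IsProbabilityMeasure μ3] [IsProbabilityMeasure μ2]
    (h3 : ∀ (n : ℕ) (w : ℕ → Fin 3), μ3 {x | ∀ i < n, x i = w i} = (1 / 3 : ℝ≥0∞) ^ n)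
    (h2 : ∀ (n : ℕ) (w : ℕ → Bool), μ2 {y | ∀ i < n, y i = w i} = (1 / 2 : ℝ≥0∞) ^ n)
    (n : ℕ) (w : ℕ → Bool) (b : Bool) :
    (μ3.prod μ2) ({p | ∀ i < n, PhiMap p.1 p.2 i = w i} ∩ {p | PhiMap p.1 p.2 n = b}) =
      (μ3.prod μ2) ({p | ∀ i < n, PhiMap p.1 p.2 i = w i} ∩ {p | PhiMap p.1 p.2 n = !b}) := by
  have hA : ∀ c : Bool, MeasurableSet ({p : (ℕ → Fin 3) × (ℕ → Bool) |
      ∀ i < n, PhiMap p.1 p.2 i = w i} ∩ {p | PhiMap p.1 p.2 n = c}) := fun c =>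
    (measurableSet_PhiMap_cylinder n w).inter (measurableSet_PhiMap_eq n c)
  have hR : ∀ r : ℕ, MeasurableSet
      ((fun p : (ℕ → Fin 3) × (ℕ → Bool) => pathRank p.1 p.2 n) ⁻¹' {r}) := fun r =>
    (continuous_pathRank n).measurable (measurableSet_singleton r)
  have hsum : ∀ c : Bool, (μ3.prod μ2) ({p : (ℕ → Fin 3) × (ℕ → Bool) |
      ∀ i < n, PhiMap p.1 p.2 i = w i} ∩ {p | PhiMap p.1 p.2 n = c}) =
      ∑' r : ℕ, (μ3.prod μ2) (({p : (ℕ → Fin 3) × (ℕ → Bool) |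
        ∀ i < n, PhiMap p.1 p.2 i = w i} ∩ {p | PhiMap p.1 p.2 n = c}) ∩
        (fun p => pathRank p.1 p.2 n) ⁻¹' {r}) := fun c => by
    rw [← measure_iUnion _ fun r => (hA c).inter (hR r), ← Set.inter_iUnion,
      ← Set.preimage_iUnion, Set.iUnion_of_singleton, Set.preimage_univ, Set.inter_univ]
    exact fun r s hrs => Set.disjoint_left.mpr fun p hp hq => hrs (hp.2.symm.trans hq.2)
  rw [hsum b, hsum (!b)]
  refine tsum_congr fun r => ?_
  rw [← (measurePreserving_swapAt_flipAt h3 h2 r n).measure_preimage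
    ((hA (!b)).inter (hR r)).nullMeasurableSet]
  congr 1
  ext p
  have hinv : ∀ (i : ℕ) (c : Fin 3), swapAt r i (swapAt r i c) = c := fun i c => by
    unfold swapAt; split_ifs <;> simp
  have hinv' : ∀ (i : ℕ) (c : Bool), flipAt n i (flipAt n i c) = c := fun i c => by
    unfold flipAt; split_ifs <;> simp
  simp only [Set.mem_inter_iff, Set.mem_ofPred_eq, Set.mem_preimage, Set.mem_singleton_iff]
  constructor
  · rintro ⟨⟨hw, hb⟩, hr⟩
    obtain ⟨h1, h2⟩ := pathRank_swapAt hr.le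
    exact ⟨⟨fun i hi => (h2 i hi).trans (hw i hi), by rw [PhiMap_swapAt hr, hb]⟩, h1.trans hr⟩
  · rintro ⟨⟨hw, hb⟩, hr⟩
    obtain ⟨h1, h2⟩ := pathRank_swapAt hr.le
    have h3 := PhiMap_swapAt hr
    simp only [hinv, hinv'] at h1 h2 h3
    exact ⟨⟨fun i hi => (h2 i hi).trans (hw i hi), by rw [h3, hb, Bool.not_not]⟩, h1.trans hr⟩

theorem measure_PhiMap_cylinder {μ3 : Measure (ℕ → Fin 3)} {μ2 : Measure (ℕ → Bool)}
    [IsProbabilityMeasure μ3] [IsProbabilityMeasure μ2]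
    (h3 : ∀ (n : ℕ) (w : ℕ → Fin 3), μ3 {x | ∀ i < n, x i = w i} = (1 / 3 : ℝ≥0∞) ^ n)
    (h2 : ∀ (n : ℕ) (w : ℕ → Bool), μ2 {y | ∀ i < n, y i = w i} = (1 / 2 : ℝ≥0∞) ^ n)
    (n : ℕ) (w : ℕ → Bool) :
    (μ3.prod μ2) {p | ∀ i < n, PhiMap p.1 p.2 i = w i} = (1 / 2 : ℝ≥0∞) ^ n := by
  induction n with
  | zero => simp
  | succ n ih =>
    have hsplit := measure_inter_add_sdiff (μ := μ3.prod μ2)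
      {p : (ℕ → Fin 3) × (ℕ → Bool) | ∀ i < n, PhiMap p.1 p.2 i = w i}
      (measurableSet_PhiMap_eq n (w n))
    have hdiff : {p : (ℕ → Fin 3) × (ℕ → Bool) | ∀ i < n, PhiMap p.1 p.2 i = w i} \
        {p | PhiMap p.1 p.2 n = w n} =
        {p | ∀ i < n, PhiMap p.1 p.2 i = w i} ∩ {p | PhiMap p.1 p.2 n = !(w n)} := by
      ext p
      simp [Bool.eq_not]
    have hsucc : {p : (ℕ → Fin 3) × (ℕ → Bool) | ∀ i < n + 1, PhiMap p.1 p.2 i = w i} =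
        {p | ∀ i < n, PhiMap p.1 p.2 i = w i} ∩ {p | PhiMap p.1 p.2 n = w n} := by
      ext p
      exact Nat.forall_lt_succ_right
    rw [hdiff, ← measure_PhiMap_bit_flip h3 h2, ← hsucc, ih, ← two_mul] at hsplit
    rw [pow_succ, ← hsplit, mul_comm, ← mul_assoc, one_div,
      ENNReal.inv_mul_cancel two_ne_zero ENNReal.ofNat_ne_top, one_mul]

/-- Let `λ₃` (resp. `λ₂`) be the uniform product measure on `{0,1,2}^ω` (resp. `{0,1}^ω`),
characterized by its values on cylinders.  Then the map `Φ` is (total and) continuous,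
`Φ(x,y)` is a path through `T_x` for every pair `(x,y)`, and the pushforward of `λ₃ ⊗ λ₂`
under `Φ` is `λ₂`. -/
theorem phi_continuous_path_pushforward
    (μ3 : Measure (ℕ → Fin 3)) (μ2 : Measure (ℕ → Bool))
    [IsProbabilityMeasure μ3] [IsProbabilityMeasure μ2]
    (h3 : ∀ (n : ℕ) (w : ℕ → Fin 3), μ3 {x | ∀ i < n, x i = w i} = (1 / 3 : ℝ≥0∞) ^ n)
    (h2 : ∀ (n : ℕ) (w : ℕ → Bool), μ2 {y | ∀ i < n, y i = w i} = (1 / 2 : ℝ≥0∞) ^ n) :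
    Continuous (fun p : (ℕ → Fin 3) × (ℕ → Bool) => PhiMap p.1 p.2) ∧
      (∀ (x : ℕ → Fin 3) (y : ℕ → Bool) (n : ℕ), memT x (initSeg (PhiMap x y) n) = true) ∧
      Measure.map (fun p : (ℕ → Fin 3) × (ℕ → Bool) => PhiMap p.1 p.2) (μ3.prod μ2) = μ2 := by
  refine ⟨continuous_PhiMap, fun x y n => by rw [initSeg_PhiMap, memT_phiList], ?_⟩
  have hΦ := continuous_PhiMap.measurable
  have := Measure.isProbabilityMeasure_map (μ := μ3.prod μ2) hΦ.aemeasurable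
  refine measure_ext_of_cylinder fun n w => ?_
  have ho : MeasurableSet {z : ℕ → Bool | ∀ i < n, z i = w i} :=
    (PiNat.isOpen_cylinder (fun _ : ℕ => Bool) w n).measurableSet
  rw [h2, Measure.map_apply hΦ ho]
  exact measure_PhiMap_cylinder h3 h2 n w
end

section
/- For x ∈ {0,1,2}^ω, let T(x) = {σ ∈ {0,1}^{<ω} : ℓ_x(σ↾k) ∈ {0,2} for all 1 ≤ k ≤ |σ|} (a binary tree containing the empty string). Then the pushforward of λ₃ under the map x ↦ T(x) equals the pushforward of μ_GW under the map z ↦ S_z, as Borel measures on the space of subsets of {0,1}^{<ω} (identified with the product space {0,1}^({0,1}^{<ω}) with the product topology). -/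
open MeasureTheory
open scoped ENNReal

/-- The tree `S_z ⊆ {0,1}^{<ω}` coded by `z ∈ {0,1,2,3}^ω`: the empty string is in `S_z`,
and if `σ` is the `(i+1)`-st element of `S_z` in length-lexicographic order then `z i = 0`
keeps only `σ0`, `z i = 1` keeps only `σ1`, `z i = 2` keeps both children, and `z i = 3`
keeps neither. -/
def memS (z : ℕ → Fin 4) : List Bool → Bool :=
  memTree (fun i b => decide (z i = 2 ∨ (z i = 0 ∧ b = false) ∨ (z i = 1 ∧ b = true)))

/-- The label in `{0,1,2}` assigned by `x ∈ {0,1,2}^ω` to a nonempty binary string: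
`ℓ_x(σ_i) = x (i − 1)`, where `σ_i` is the `i`-th string in length-lexicographic order. -/
def labelOf (x : ℕ → Fin 3) (σ : List Bool) : Fin 3 := x (strIdx σ - 1)

/-- The tree `T(x)` of binary strings all of whose labels under `ℓ_x` lie in `{0,2}`. -/
def Tfun (x : ℕ → Fin 3) (σ : List Bool) : Bool :=
  decide (∀ k < σ.length, labelOf x (σ.take (k + 1)) ≠ 1)

/-- The Galton–Watson weight of a digit in `{0,1,2,3}`: `2/9`, `2/9`, `4/9`, `1/9`. -/
noncomputable def gwW (d : Fin 4) : ℝ≥0∞ :=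
  if d = 0 then 2 / 9 else if d = 1 then 2 / 9 else if d = 2 then 4 / 9 else 1 / 9

theorem strVal_append (σ : List Bool) (b : Bool) :
    strVal (σ ++ [b]) = 2 * strVal σ + b.toNat := by
  simp [strVal]

theorem strAt_succ (n : ℕ) : strAt (n + 1) = strAt (n / 2) ++ [decide (n % 2 = 1)] := by
  rw [strAt]

theorem strAt_strIdx (σ : List Bool) : strAt (strIdx σ) = σ := by
  induction σ using List.reverseRecOn with
  | nil => simp [strAt, strIdx, strVal]
  | append_singleton σ b ih =>
    rw [strIdx_append, strAt_succ]
    have h₁ : (2 * strIdx σ + b.toNat) / 2 = strIdx σ := by have := b.toNat_le; omega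
    have h₂ : (2 * strIdx σ + b.toNat) % 2 = b.toNat := by cases b <;> simp
    rw [h₁, h₂, ih]
    cases b <;> rfl

theorem nodeMem_succ_s10 (allow : ℕ → Bool → Bool) (m : ℕ) :
    nodeMem allow (m + 1) = (nodeMem allow (m / 2) &&
      allow ((Finset.range (m / 2)).filter (fun j => nodeMem allow j = true)).card
        (decide (m % 2 = 1))) := by
  have hfilter : (Finset.range (m / 2)).filter (fun j => treeAux allow (m + 1) j = true) =
      (Finset.range (m / 2)).filter (fun j => nodeMem allow j = true) := by
    refine Finset.filter_congr fun j hj => ?_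
    rw [Finset.mem_range] at hj
    rw [treeAux_eq_nodeMem allow (show j < m + 1 by omega)]
  have hlast : (strAt (m / 2) ++ [decide (m % 2 = 1)]).getLast! = decide (m % 2 = 1) := by
    rw [List.getLast!_eq_getLast?_getD, List.getLast?_concat, Option.getD_some]
  rw [nodeMem, treeAux, if_neg (lt_irrefl _), if_neg (Nat.succ_ne_zero m)]
  simp only [strAt_succ, List.dropLast_concat, strIdx_strAt, hlast, hfilter,
    treeAux_eq_nodeMem allow (show m / 2 < m + 1 by omega)]
  cases nodeMem allow (m / 2) <;> simp

theorem memTree_strAt (allow : ℕ → Bool → Bool) (m : ℕ) :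
    memTree allow (strAt m) = nodeMem allow m := by
  rw [memTree, strIdx_strAt, nodeMem]

theorem Tfun_strAt_zero (x : ℕ → Fin 3) : Tfun x (strAt 0) = true := by
  simp [Tfun, strAt]

theorem Tfun_strAt_succ (x : ℕ → Fin 3) (m : ℕ) :
    Tfun x (strAt (m + 1)) = (Tfun x (strAt (m / 2)) && decide (x m ≠ 1)) := by
  have hm : strIdx (strAt (m / 2) ++ [decide (m % 2 = 1)]) = m + 1 := by
    rw [← strAt_succ, strIdx_strAt]
  rw [Bool.eq_iff_iff, strAt_succ]
  simp only [Tfun, decide_eq_true_eq, Bool.and_eq_true, List.length_append,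
    List.length_singleton, Nat.forall_lt_succ_right]
  refine and_congr (forall₂_congr fun k hk => ?_) ?_
  · rw [List.take_append_of_le_length (by omega)]
  · rw [List.take_of_length_le (by simp), labelOf, hm, Nat.add_sub_cancel]

/-- The cylinder of subsets of `{0,1}^{<ω}` whose indicator agrees with `w` on the first
`2 * n + 1` strings. -/
def treeCyl (n : ℕ) (w : ℕ → Bool) : Set (List Bool → Bool) :=
  {f | ∀ m < 2 * n + 1, f (strAt m) = w m}

theorem isPiSystem_treeCyl : IsPiSystem {S | ∃ n w, S = treeCyl n w} := by
  rintro _ ⟨n, w, rfl⟩ _ ⟨n', w', rfl⟩ ⟨g, hg, hg'⟩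
  refine ⟨max n n', fun m => g (strAt m), ?_⟩
  ext f
  simp only [treeCyl, Set.mem_inter_iff, Set.mem_ofPred_eq] at hg hg' ⊢
  constructor
  · rintro ⟨h, h'⟩ m hm
    by_cases hn : m < 2 * n + 1
    · rw [h m hn, hg m hn]
    · rw [h' m (by omega), hg' m (by omega)]
  · intro h
    exact ⟨fun m hm => by rw [h m (by omega), hg m hm],
      fun m hm => by rw [h m (by omega), hg' m hm]⟩

theorem measurableSet_treeCyl (n : ℕ) (w : ℕ → Bool) : MeasurableSet (treeCyl n w) := by
  simp only [treeCyl, Set.ofPred_forall]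
  exact MeasurableSet.iInter fun m => MeasurableSet.iInter fun _ =>
    measurableSet_eq_fun (measurable_pi_apply _) measurable_const

theorem pi_eq_generateFrom_treeCyl :
    (MeasurableSpace.pi : MeasurableSpace (List Bool → Bool)) =
      MeasurableSpace.generateFrom {S | ∃ n w, S = treeCyl n w} := by
  apply le_antisymm
  · refine iSup_le fun σ => ?_
    rintro _ ⟨B, -, rfl⟩
    have hunion : (fun f : List Bool → Bool => f σ) ⁻¹' B =
        ⋃ (u : Fin (2 * strIdx σ + 1) → Bool) (_ : u ⟨strIdx σ, by omega⟩ ∈ B),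
          treeCyl (strIdx σ) (fun m => if h : m < 2 * strIdx σ + 1 then u ⟨m, h⟩ else false) := by
      ext f
      simp only [treeCyl, Set.mem_preimage, Set.mem_iUnion, Set.mem_ofPred_eq, exists_prop]
      constructor
      · intro hf
        refine ⟨fun m => f (strAt m), by simpa only [strAt_strIdx] using hf, fun m hm => by rw [dif_pos hm]⟩
      · rintro ⟨u, hu, h⟩
        have := h (strIdx σ) (by omega)
        rw [dif_pos (by omega), strAt_strIdx] at this
        rwa [this]
    rw [hunion]
    exact MeasurableSet.iUnion fun u => MeasurableSet.iUnion fun _ =>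
      MeasurableSpace.measurableSet_generateFrom ⟨_, _, rfl⟩
  · refine MeasurableSpace.generateFrom_le ?_
    rintro _ ⟨n, w, rfl⟩
    exact measurableSet_treeCyl n w

theorem measurable_of_preimage_treeCyl {α : Type*} [MeasurableSpace α]
    {F : α → List Bool → Bool} (h : ∀ n w, MeasurableSet (F ⁻¹' treeCyl n w)) :
    Measurable F := by
  rw [pi_eq_generateFrom_treeCyl]
  refine measurable_generateFrom ?_
  rintro _ ⟨n, w, rfl⟩
  exact h n w

/-- The probability that a node has the indicated membership status, given the status of its
parent, when every child of a member is kept with probability `2 / 3`. -/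
noncomputable def childWeight : Bool → Bool → ℝ≥0∞
  | true, true => 2 / 3
  | true, false => 1 / 3
  | false, true => 0
  | false, false => 1

/-- The probability of the cylinder `treeCyl n w`. -/
noncomputable def treeWeight (w : ℕ → Bool) (n : ℕ) : ℝ≥0∞ :=
  (if w 0 then 1 else 0) * ∏ j ∈ Finset.range (2 * n), childWeight (w (j / 2)) (w (j + 1))

theorem treeWeight_succ (w : ℕ → Bool) (n : ℕ) :
    treeWeight w (n + 1) = treeWeight w n *
      (childWeight (w n) (w (2 * n + 1)) * childWeight (w n) (w (2 * n + 2))) := by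
  have h₁ : 2 * n / 2 = n := by omega
  have h₂ : (2 * n + 1) / 2 = n := by omega
  rw [treeWeight, treeWeight, show 2 * (n + 1) = 2 * n + 1 + 1 by ring,
    Finset.prod_range_succ, Finset.prod_range_succ, h₁, h₂]
  ring

/-- The digits of `x` for which a node has the indicated membership status in `T(x)`, given
the status of its parent. -/
def childDigits : Bool → Bool → Finset (Fin 3)
  | true, true => {0, 2}
  | true, false => {1}
  | false, true => ∅
  | false, false => Finset.univ

theorem mem_childDigits (p c : Bool) (d : Fin 3) :
    d ∈ childDigits p c ↔ (p && decide (d ≠ 1)) = c := by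
  revert p c d; decide

theorem card_childDigits (p c : Bool) :
    ((childDigits p c).card : ℝ≥0∞) * (1 / 3) = childWeight p c := by
  have h : (3 : ℝ≥0∞) * 3⁻¹ = 1 := ENNReal.mul_inv_cancel (by norm_num) (by norm_num)
  cases p <;> cases c <;> simp [childDigits, childWeight, div_eq_mul_inv, h]

theorem Tfun_agree_iff (x : ℕ → Fin 3) (w : ℕ → Bool) (hw : w 0 = true) (N : ℕ) :
    (∀ m < N + 1, Tfun x (strAt m) = w m) ↔
      ∀ j < N, x j ∈ childDigits (w (j / 2)) (w (j + 1)) := by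
  induction N with
  | zero => simp [Tfun_strAt_zero, hw]
  | succ N ih =>
    refine Nat.forall_lt_succ_right.trans (Iff.trans ?_ Nat.forall_lt_succ_right.symm)
    rw [← ih]
    refine and_congr_right fun h => ?_
    rw [Tfun_strAt_succ, h (N / 2) (by omega), mem_childDigits]

theorem preimage_Tfun_treeCyl (n : ℕ) (w : ℕ → Bool) :
    (fun (x : ℕ → Fin 3) (σ : List Bool) => Tfun x σ) ⁻¹' treeCyl n w =
      if w 0 then {x | ∀ j < 2 * n, x j ∈ childDigits (w (j / 2)) (w (j + 1))} else ∅ := by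
  split_ifs with hw
  · ext x
    exact Tfun_agree_iff x w hw (2 * n)
  · refine Set.eq_empty_of_forall_notMem fun x hx => hw ?_
    rw [← hx 0 (by omega)]
    exact Tfun_strAt_zero x

theorem measurableSet_cylinder {α : Type*} [MeasurableSpace α] [DiscreteMeasurableSpace α]
    (n : ℕ) (B : ℕ → Set α) : MeasurableSet {x : ℕ → α | ∀ i < n, x i ∈ B i} := by
  simp only [Set.ofPred_forall]
  exact MeasurableSet.iInter fun i => MeasurableSet.iInter fun _ =>
    measurable_pi_apply i (MeasurableSet.of_discrete (s := B i))

theorem measure_box (μ3 : Measure (ℕ → Fin 3))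
    (h3 : ∀ (n : ℕ) (w : ℕ → Fin 3), μ3 {x | ∀ i < n, x i = w i} = (1 / 3 : ℝ≥0∞) ^ n)
    (N : ℕ) (B : ℕ → Finset (Fin 3)) :
    μ3 {x | ∀ j < N, x j ∈ B j} = ∏ j ∈ Finset.range N, ((B j).card : ℝ≥0∞) * (1 / 3) := by
  let C : (Fin N → Fin 3) → Set (ℕ → Fin 3) := fun u => {x | ∀ j (h : j < N), x j = u ⟨j, h⟩}
  have hC (u : Fin N → Fin 3) :
      C u = {x | ∀ j < N, x j = if h : j < N then u ⟨j, h⟩ else 0} := by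
    ext x
    exact forall₂_congr fun j hj => by rw [dif_pos hj]
  have hunion : {x : ℕ → Fin 3 | ∀ j < N, x j ∈ B j} =
      ⋃ u ∈ Fintype.piFinset (fun j : Fin N => B j), C u := by
    ext x
    simp only [C, Set.mem_ofPred_eq, Set.mem_iUnion, Fintype.mem_piFinset, exists_prop]
    constructor
    · intro h
      exact ⟨fun j => x j, fun j => h j j.2, fun _ _ => rfl⟩
    · rintro ⟨u, hu, h⟩ j hj
      rw [h j hj]
      exact hu ⟨j, hj⟩
  rw [hunion, measure_biUnion_finset]
  · simp only [hC, h3, Finset.sum_const, Fintype.card_piFinset, nsmul_eq_mul]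
    rw [Finset.prod_mul_distrib, Finset.prod_const, Finset.card_range, Nat.cast_prod,
      Fin.prod_univ_eq_prod_range (fun j => ((B j).card : ℝ≥0∞))]
  · intro u _ v _ huv
    refine Set.disjoint_left.mpr fun x hu hv => huv ?_
    ext1 j
    rw [← hu j j.2, ← hv j j.2]
  · intro u _
    rw [hC]
    exact measurableSet_cylinder N fun j => {_}

/-- The digit whose rule keeps the left child iff `l` and the right child iff `r`. -/
def branchDigit : Bool → Bool → Fin 4
  | true, true => 2
  | true, false => 0
  | false, true => 1
  | false, false => 3

/-- The branching rule of `memS`. -/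
def allowS (z : ℕ → Fin 4) (i : ℕ) (b : Bool) : Bool :=
  decide (z i = 2 ∨ (z i = 0 ∧ b = false) ∨ (z i = 1 ∧ b = true))

theorem allowS_eq_iff (z : ℕ → Fin 4) (i : ℕ) (l r : Bool) :
    (allowS z i false = l ∧ allowS z i true = r) ↔ z i = branchDigit l r := by
  unfold allowS
  generalize z i = d
  revert l r d; decide

theorem gwW_branchDigit (l r : Bool) :
    gwW (branchDigit l r) = childWeight true l * childWeight true r := by
  have h : (9 : ℝ≥0∞)⁻¹ = 3⁻¹ * 3⁻¹ := by
    rw [← ENNReal.mul_inv (by norm_num) (by norm_num)]; norm_num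
  cases l <;> cases r <;> simp [branchDigit, gwW, childWeight, div_eq_mul_inv, h] <;> ring

theorem preimage_memS_treeCyl (n : ℕ) (w : ℕ → Bool) :
    let A := (fun (z : ℕ → Fin 4) (σ : List Bool) => memS z σ) ⁻¹' treeCyl n w
    let k := ((Finset.range n).filter (fun j => w j = true)).card
    (A = ∅ ∧ treeWeight w n = 0) ∨
      ∃ v : ℕ → Fin 4, A = {z | ∀ i < k, z i = v i} ∧
        ∏ i ∈ Finset.range k, gwW (v i) = treeWeight w n := by
  have hA (n : ℕ) : (fun (z : ℕ → Fin 4) (σ : List Bool) => memS z σ) ⁻¹' treeCyl n w =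
      {z | ∀ m < 2 * n + 1, nodeMem (allowS z) m = w m} := by
    ext z
    exact forall₂_congr fun m _ => by rw [← memTree_strAt]; rfl
  simp only [hA]
  induction n with
  | zero =>
    cases hw : w 0
    · left; simp [nodeMem_zero, hw, treeWeight]
    · right; exact ⟨fun _ => 0, by simp [nodeMem_zero, hw, treeWeight]⟩
  | succ n ih =>
    set k := ((Finset.range n).filter (fun j => w j = true)).card with hk
    have hstep : {z | ∀ m < 2 * (n + 1) + 1, nodeMem (allowS z) m = w m} =
        {z | ∀ m < 2 * n + 1, nodeMem (allowS z) m = w m} ∩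
          {z | (w n && allowS z k false) = w (2 * n + 1) ∧
            (w n && allowS z k true) = w (2 * n + 2)} := by
      ext z
      simp only [Set.mem_ofPred_eq, Set.mem_inter_iff,
        show 2 * (n + 1) + 1 = 2 * n + 1 + 1 + 1 by ring]
      rw [Nat.forall_lt_succ_right, Nat.forall_lt_succ_right (n := 2 * n + 1), and_assoc]
      refine and_congr_right fun h => ?_
      have hcard : ((Finset.range n).filter (fun j => nodeMem (allowS z) j = true)).card = k := by
        rw [hk]
        congr 1
        refine Finset.filter_congr fun j hj => ?_
        rw [Finset.mem_range] at hj
        rw [h j (by omega)]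
      rw [nodeMem_succ_s10, nodeMem_succ_s10, show 2 * n / 2 = n by omega,
        show (2 * n + 1) / 2 = n by omega, hcard, h n (by omega),
        show 2 * n % 2 = 0 by omega, show (2 * n + 1) % 2 = 1 by omega]
      rfl
    rw [hstep, treeWeight_succ, Finset.range_add_one, Finset.filter_insert]
    rcases ih with ⟨hempty, hzero⟩ | ⟨v, hv, hprod⟩
    · left
      rw [hempty, hzero, Set.empty_inter, zero_mul]
      exact ⟨rfl, rfl⟩
    rw [hv]
    cases hwn : w n
    · simp only [Bool.false_and, Bool.false_eq_true, if_false]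
      by_cases h : w (2 * n + 1) = false ∧ w (2 * n + 2) = false
      · right
        exact ⟨v, by simp [h, ← hk], by simp [h, ← hk, hprod, childWeight]⟩
      · left
        constructor
        · ext z
          simp only [Set.mem_inter_iff, Set.mem_ofPred_eq, Set.mem_empty_iff_false, iff_false]
          exact fun hz => h ⟨hz.2.1.symm, hz.2.2.symm⟩
        · cases h₁ : w (2 * n + 1) <;> cases h₂ : w (2 * n + 2) <;> simp_all [childWeight]
    · right
      simp only [Bool.true_and, if_true]
      rw [Finset.card_insert_of_notMem (by simp), ← hk]
      have hne {i : ℕ} (hi : i < k) (d : Fin 4) : Function.update v k d i = v i :=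
        Function.update_of_ne hi.ne _ _
      refine ⟨Function.update v k (branchDigit (w (2 * n + 1)) (w (2 * n + 2))), ?_, ?_⟩
      · ext z
        simp only [Set.mem_inter_iff, Set.mem_ofPred_eq, allowS_eq_iff]
        rw [Nat.forall_lt_succ_right, Function.update_self]
        exact and_congr_left fun _ => forall₂_congr fun i hi => by rw [hne hi]
      · rw [Finset.prod_range_succ, Function.update_self, gwW_branchDigit, ← hprod]
        congr 1
        exact Finset.prod_congr rfl fun i hi => by rw [hne (Finset.mem_range.mp hi)]

/-- Let `λ₃` be the uniform product measure on `{0,1,2}^ω` and `μ_GW` the Galton–Watson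
measure on `{0,1,2,3}^ω`, characterized by their values on cylinders.  Then the pushforward
of `λ₃` under `x ↦ T(x)` equals the pushforward of `μ_GW` under `z ↦ S_z`, as measures on
the space of subsets of `{0,1}^{<ω}` (identified with `{0,1}^({0,1}^{<ω})`). -/
theorem pushforward_Tfun_eq_pushforward_GW
    (μ3 : Measure (ℕ → Fin 3)) (μGW : Measure (ℕ → Fin 4))
    [IsProbabilityMeasure μ3] [IsProbabilityMeasure μGW]
    (h3 : ∀ (n : ℕ) (w : ℕ → Fin 3), μ3 {x | ∀ i < n, x i = w i} = (1 / 3 : ℝ≥0∞) ^ n)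
    (hGW : ∀ (n : ℕ) (w : ℕ → Fin 4),
      μGW {z | ∀ i < n, z i = w i} = ∏ i ∈ Finset.range n, gwW (w i)) :
    Measure.map (fun (x : ℕ → Fin 3) (σ : List Bool) => Tfun x σ) μ3 =
      Measure.map (fun (z : ℕ → Fin 4) (σ : List Bool) => memS z σ) μGW := by
  have hT (n : ℕ) (w : ℕ → Bool) : MeasurableSet
      ((fun (x : ℕ → Fin 3) (σ : List Bool) => Tfun x σ) ⁻¹' treeCyl n w) := by
    rw [preimage_Tfun_treeCyl]
    split_ifs
    · exact measurableSet_cylinder (2 * n) fun j =>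
        (childDigits (w (j / 2)) (w (j + 1)) : Set (Fin 3))
    · exact MeasurableSet.empty
  have hS (n : ℕ) (w : ℕ → Bool) : MeasurableSet
      ((fun (z : ℕ → Fin 4) (σ : List Bool) => memS z σ) ⁻¹' treeCyl n w) := by
    rcases preimage_memS_treeCyl n w with ⟨h, -⟩ | ⟨v, h, -⟩ <;> rw [h]
    · exact MeasurableSet.empty
    · exact measurableSet_cylinder _ fun i => {v i}
  have mT := measurable_of_preimage_treeCyl hT
  have mS := measurable_of_preimage_treeCyl hS
  have := Measure.isProbabilityMeasure_map (μ := μ3) mT.aemeasurable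
  have := Measure.isProbabilityMeasure_map (μ := μGW) mS.aemeasurable
  refine ext_of_generate_finite _ pi_eq_generateFrom_treeCyl isPiSystem_treeCyl ?_ (by simp)
  rintro _ ⟨n, w, rfl⟩
  rw [Measure.map_apply mT (measurableSet_treeCyl n w),
    Measure.map_apply mS (measurableSet_treeCyl n w)]
  trans treeWeight w n
  · rw [preimage_Tfun_treeCyl, treeWeight]
    split_ifs
    · simp only [measure_box μ3 h3, card_childDigits, one_mul]
    · simp
  · rcases preimage_memS_treeCyl n w with ⟨h, h'⟩ | ⟨v, h, h'⟩
    · rw [h, h', measure_empty]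
    · rw [h, ← h', hGW]
end

section
/- For every finite binary string σ, the integral over x ∈ {0,1,2}^ω (with respect to λ₃) of λ₂({y ∈ dom(F_x) : F_x(y) ∈ [σ]}) equals 2^{−|σ|}; that is, the averaged pushforward measure induced by the coding of continuous functions has barycenter the uniform measure λ₂. -/
open MeasureTheory
open scoped ENNReal

/-- The label read along `y` at stage `n`, namely `ℓ_x(y↾(n+1))`. -/
def flabel (x : ℕ → Fin 3) (y : ℕ → Bool) (n : ℕ) : Fin 3 := labelOf x (initSeg y (n + 1))

/-- `y` belongs to the domain of `F_x`: infinitely many of the labels along `y` lie in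
`{0,1}`. -/
def Fdom (x : ℕ → Fin 3) (y : ℕ → Bool) : Prop := {n | flabel x y n ≠ 2}.Infinite

/-- The value `F_x(y)(k)`: the `k`-th label along `y` lying in `{0,1}` (obtained by deleting
all labels `2`), read as a bit.  (Junk value if `y ∉ dom F_x`.) -/
noncomputable def Fapp (x : ℕ → Fin 3) (y : ℕ → Bool) (k : ℕ) : Bool :=
  decide (flabel x y (Nat.nth (fun n => flabel x y n ≠ 2) k) = 1)

theorem measurableSet_coordinate {α : Type*} [Countable α] [MeasurableSpace α]
    [MeasurableSingletonClass α] (m : ℕ) (p : α → Prop) :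
    MeasurableSet {z : ℕ → α | p (z m)} :=
  have h : MeasurableSet ((fun z : ℕ → α => z m) ⁻¹' {a | p a}) :=
    measurable_pi_apply m (Set.to_countable _).measurableSet
  h

/-- The basic cylinders of infinite sequences over `α`, together with the empty set. -/
def seqCylinders (α : Type*) : Set (Set (ℕ → α)) :=
  {s | s = ∅ ∨ ∃ (n : ℕ) (w : ℕ → α), s = {x | ∀ i < n, x i = w i}}

theorem isPiSystem_seqCylinders (α : Type*) : IsPiSystem (seqCylinders α) := by
  rintro s (rfl | ⟨n, w, rfl⟩) t (rfl | ⟨m, v, rfl⟩) ⟨z, hz⟩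
  · simp at hz
  · simp at hz
  · simp at hz
  · refine Or.inr ⟨max n m, z, ?_⟩
    ext x
    simp only [Set.mem_inter_iff, Set.mem_ofPred_eq] at hz ⊢
    constructor
    · rintro ⟨h1, h2⟩ i hi
      rcases lt_max_iff.1 hi with h | h
      · rw [h1 i h, hz.1 i h]
      · rw [h2 i h, hz.2 i h]
    · intro h
      exact ⟨fun i hi => by rw [h i (lt_max_of_lt_left hi), hz.1 i hi],
        fun i hi => by rw [h i (lt_max_of_lt_right hi), hz.2 i hi]⟩

theorem measurableSet_seqCylinder {α : Type*} [Countable α] [MeasurableSpace α]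
    [MeasurableSingletonClass α] (n : ℕ) (w : ℕ → α) :
    MeasurableSet {x : ℕ → α | ∀ i < n, x i = w i} := by
  simp only [Set.ofPred_forall]
  exact MeasurableSet.iInter fun i => MeasurableSet.iInter fun _ =>
    measurableSet_coordinate i (· = w i)

theorem generateFrom_seqCylinders (α : Type*) [Finite α] [MeasurableSpace α]
    [MeasurableSingletonClass α] :
    MeasurableSpace.generateFrom (seqCylinders α) = MeasurableSpace.pi := by
  apply le_antisymm
  · apply MeasurableSpace.generateFrom_le
    rintro s (rfl | ⟨n, w, rfl⟩)
    · exact MeasurableSet.empty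
    · exact measurableSet_seqCylinder n w
  · refine iSup_le fun i => ?_
    rintro _ ⟨t, -, rfl⟩
    have key : (fun x : ℕ → α => x i) ⁻¹' t =
        ⋃ p : {p : Fin (i + 1) → α // p (Fin.last i) ∈ t},
          {x | ∀ j < i + 1, x j = p.1 (Fin.ofNat (i + 1) j)} := by
      ext x
      simp only [Set.mem_preimage, Set.mem_iUnion, Set.mem_ofPred_eq]
      constructor
      · intro h
        refine ⟨⟨fun j => x j, by simpa using h⟩, fun j hj => ?_⟩
        simp [Nat.mod_eq_of_lt hj]
      · rintro ⟨⟨p, hp⟩, h⟩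
        have h' := h i (Nat.lt_succ_self i)
        have e : Fin.ofNat (i + 1) i = Fin.last i := by
          ext
          simp
        rw [e] at h'
        rw [h']
        exact hp
    rw [key]
    exact MeasurableSet.iUnion fun p => MeasurableSpace.measurableSet_generateFrom
      (Or.inr ⟨i + 1, fun j => p.1 (Fin.ofNat (i + 1) j), rfl⟩)

theorem ext_of_seqCylinders {α : Type*} [Finite α] [MeasurableSpace α]
    [MeasurableSingletonClass α] {μ ν : Measure (ℕ → α)} [IsFiniteMeasure μ]
    (huniv : μ Set.univ = ν Set.univ)
    (h : ∀ (n : ℕ) (w : ℕ → α), μ {x | ∀ i < n, x i = w i} = ν {x | ∀ i < n, x i = w i}) :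
    μ = ν := by
  refine ext_of_generate_finite (seqCylinders α) (generateFrom_seqCylinders α).symm
    (isPiSystem_seqCylinders α) ?_ huniv
  rintro s (rfl | ⟨n, w, rfl⟩)
  · simp
  · exact h n w

/-- `μ` gives every cylinder of length `n` in `{0,1,2}^ω` the mass `3^{-n}`. -/
def IsUniformTernary (μ : Measure (ℕ → Fin 3)) : Prop :=
  ∀ (n : ℕ) (w : ℕ → Fin 3), μ {x | ∀ i < n, x i = w i} = (1 / 3 : ℝ≥0∞) ^ n

namespace IsUniformTernary

variable {μ ν : Measure (ℕ → Fin 3)}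

theorem measure_univ (hμ : IsUniformTernary μ) : μ Set.univ = 1 := by
  simpa using hμ 0 0

theorem eq (hμ : IsUniformTernary μ) (hν : IsUniformTernary ν) : μ = ν := by
  have : IsFiniteMeasure μ := ⟨by simp [hμ.measure_univ]⟩
  exact ext_of_seqCylinders (by rw [hμ.measure_univ, hν.measure_univ])
    fun n w => by rw [hμ n w, hν n w]

theorem map_infinitePi {e : ℕ → ℕ} (he : Function.Injective e) :
    IsUniformTernary ((Measure.infinitePi fun _ : ℕ =>
      ProbabilityTheory.uniformOn (Set.univ : Set (Fin 3))).map fun x n => x (e n)) := by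
  intro n w
  rw [Measure.map_apply (by fun_prop) (measurableSet_seqCylinder n w)]
  have key : (fun (x : ℕ → Fin 3) n => x (e n)) ⁻¹' {x | ∀ i < n, x i = w i} =
      Set.pi ((Finset.range n).map ⟨e, he⟩ : Finset ℕ)
        (fun j => {w (Function.invFun e j)}) := by
    ext x
    simp [Set.mem_pi, Function.leftInverse_invFun he _]
  rw [key, Measure.infinitePi_pi _ (fun _ _ => measurableSet_singleton _)]
  simp [ProbabilityTheory.uniformOn_univ]

/-- Restricting the uniform measure to an injectively chosen sequence of coordinates gives the
uniform measure. -/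
theorem map_injective (hμ : IsUniformTernary μ) {e : ℕ → ℕ} (he : Function.Injective e) :
    μ.map (fun x n => x (e n)) = μ := by
  have h := map_infinitePi Function.injective_id
  simp only [id, Measure.map_id'] at h
  rw [hμ.eq h]
  exact (map_infinitePi he).eq h

theorem measure_head_inter_shift (hμ : IsUniformTernary μ) (a : Fin 3) {B : Set (ℕ → Fin 3)}
    (hB : MeasurableSet B) : μ {z | z 0 = a ∧ (fun n => z (n + 1)) ∈ B} = 3⁻¹ * μ B := by
  have hs : Measurable fun (z : ℕ → Fin 3) n => z (n + 1) := by fun_prop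
  have ha : MeasurableSet {z : ℕ → Fin 3 | z 0 = a} :=
    measurableSet_coordinate 0 (· = a)
  have hν : IsUniformTernary
      ((3 : ℝ≥0∞) • (μ.restrict {z | z 0 = a}).map fun z n => z (n + 1)) := by
    intro n w
    rw [Measure.smul_apply, Measure.map_apply hs (measurableSet_seqCylinder n w),
      Measure.restrict_apply (hs (measurableSet_seqCylinder n w))]
    have key : (fun (z : ℕ → Fin 3) n => z (n + 1)) ⁻¹' {x | ∀ i < n, x i = w i} ∩
        {z | z 0 = a} = {x | ∀ i < n + 1, x i = Nat.casesOn i a w} := by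
      ext x
      simp only [Set.mem_inter_iff, Set.mem_preimage, Set.mem_ofPred_eq]
      constructor
      · rintro ⟨h1, h2⟩ (_ | i) hi
        · exact h2
        · exact h1 i (by omega)
      · intro h
        exact ⟨fun i hi => h (i + 1) (by omega), h 0 (by omega)⟩
    rw [key, hμ, pow_succ', smul_eq_mul, ← mul_assoc, one_div,
      ENNReal.mul_inv_cancel (by simp) (by simp), one_mul]
  conv_rhs => rw [hμ.eq hν]
  rw [Measure.smul_apply, Measure.map_apply hs hB, Measure.restrict_apply (hs hB), smul_eq_mul,
    ← mul_assoc, ENNReal.inv_mul_cancel (by simp) (by simp), one_mul]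
  congr 1
  ext z
  simp [and_comm]

theorem measure_eventually_two (hμ : IsUniformTernary μ) :
    μ {z | {n | z n ≠ 2}.Infinite}ᶜ = 0 := by
  have h0 : μ {z | ∀ n, z n = 2} = 0 := by
    have hle : ∀ n : ℕ, μ {z | ∀ n, z n = 2} ≤ (1 / 3 : ℝ≥0∞) ^ n := fun n => by
      rw [← hμ n fun _ => 2]
      exact measure_mono fun z hz i _ => hz i
    have ht := ENNReal.tendsto_pow_atTop_nhds_zero_of_lt_one (r := 1 / 3) (by simp)
    exact le_antisymm (ge_of_tendsto' ht hle) zero_le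
  have hm : MeasurableSet {z : ℕ → Fin 3 | ∀ n, z n = 2} := by
    simp only [Set.ofPred_forall]
    exact MeasurableSet.iInter fun i => measurableSet_coordinate i (· = 2)
  refine measure_mono_null (t := ⋃ N : ℕ, {z | ∀ n, z (n + N) = 2}) ?_
    (measure_iUnion_null fun N => ?_)
  · intro z hz
    simp only [Set.mem_compl_iff, Set.mem_ofPred_eq, Set.not_infinite] at hz
    obtain ⟨N, hN⟩ := hz.bddAbove
    refine Set.mem_iUnion.2 ⟨N + 1, fun n => ?_⟩
    by_contra h
    have := hN h
    omega
  · have h := hμ.map_injective (add_left_injective N)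
    rw [← h, Measure.map_apply (by fun_prop) hm] at h0
    exact h0

end IsUniformTernary

/-- The bit sequence obtained from a ternary sequence by deleting the letter `2`. -/
noncomputable def deleteTwos (z : ℕ → Fin 3) (k : ℕ) : Bool :=
  decide (z (Nat.nth (fun n => z n ≠ 2) k) = 1)

/-- The ternary sequences with infinitely many letters other than `2` whose image under
deletion of the letter `2` extends `σ`. -/
def deletionCyl (σ : List Bool) : Set (ℕ → Fin 3) :=
  {z | {n | z n ≠ 2}.Infinite ∧ deleteTwos z ∈ cyl σ}

theorem mem_cyl_cons {z : ℕ → Bool} {b : Bool} {σ : List Bool} :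
    z ∈ cyl (b :: σ) ↔ z 0 = b ∧ (fun n => z (n + 1)) ∈ cyl σ := by
  rw [cyl, cyl, Set.mem_ofPred_eq, Set.mem_ofPred_eq, initSeg, initSeg, List.length_cons,
    List.range_succ_eq_map, List.map_cons, List.map_map, List.cons.injEq]
  rfl

theorem mem_cyl_iff {z : ℕ → Bool} {σ : List Bool} :
    z ∈ cyl σ ↔ ∀ (k : ℕ) (h : k < σ.length), z k = σ[k] := by
  simp only [cyl, initSeg, Set.mem_ofPred_eq]
  constructor
  · intro h k hk
    have hget := congrArg (fun l => l[k]?) h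
    simpa [hk] using hget
  · intro h
    apply List.ext_getElem
    · simp
    · intro k h1 h2
      simp [h k h2]

theorem infinite_shift_iff {p : ℕ → Prop} :
    {n | p (n + 1)}.Infinite ↔ {n | p n}.Infinite := by
  simp only [← Nat.frequently_atTop_iff_infinite]
  rw [← Filter.frequently_map (m := (· + 1)) (P := p), Filter.map_add_atTop_eq_nat]

theorem nth_of_head_false {p : ℕ → Prop} (hp : {n | p n}.Infinite) (h0 : ¬ p 0) (k : ℕ) :
    Nat.nth p k = Nat.nth (fun n => p (n + 1)) k + 1 := by
  classical
  have hs : {n | p (n + 1)}.Infinite := infinite_shift_iff.2 hp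
  have hm : p (Nat.nth (fun n => p (n + 1)) k + 1) := Nat.nth_mem_of_infinite hs k
  have hc : Nat.count p (Nat.nth (fun n => p (n + 1)) k + 1) = k := by
    rw [Nat.count_succ', if_neg h0, Nat.count_nth_of_infinite hs, add_zero]
  rw [← Nat.nth_count hm, hc]

theorem nth_succ_of_head {p : ℕ → Prop} (hp : {n | p n}.Infinite) (h0 : p 0) (k : ℕ) :
    Nat.nth p (k + 1) = Nat.nth (fun n => p (n + 1)) k + 1 := by
  classical
  have hs : {n | p (n + 1)}.Infinite := infinite_shift_iff.2 hp
  have hm : p (Nat.nth (fun n => p (n + 1)) k + 1) := Nat.nth_mem_of_infinite hs k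
  have hc : Nat.count p (Nat.nth (fun n => p (n + 1)) k + 1) = k + 1 := by
    rw [Nat.count_succ', if_pos h0, Nat.count_nth_of_infinite hs]
  rw [← Nat.nth_count hm, hc]

theorem deletionCyl_of_head_two {z : ℕ → Fin 3} (h0 : z 0 = 2) (σ : List Bool) :
    z ∈ deletionCyl σ ↔ (fun n => z (n + 1)) ∈ deletionCyl σ := by
  simp only [deletionCyl, Set.mem_ofPred_eq]
  rw [infinite_shift_iff (p := fun n => z n ≠ 2)]
  refine and_congr_right fun hz => ?_
  have : deleteTwos z = deleteTwos fun n => z (n + 1) := by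
    funext k
    simp only [deleteTwos]
    rw [nth_of_head_false hz (by simp [h0])]
  rw [this]

theorem deletionCyl_cons_of_head_ne_two {z : ℕ → Fin 3} (h0 : z 0 ≠ 2) (b : Bool)
    (σ : List Bool) : z ∈ deletionCyl (b :: σ) ↔
      decide (z 0 = 1) = b ∧ (fun n => z (n + 1)) ∈ deletionCyl σ := by
  simp only [deletionCyl, Set.mem_ofPred_eq, mem_cyl_cons]
  rw [infinite_shift_iff (p := fun n => z n ≠ 2), and_left_comm]
  have hhead : deleteTwos z 0 = decide (z 0 = 1) := by
    rw [deleteTwos, Nat.nth_zero_of_zero h0]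
  rw [hhead]
  refine and_congr_right fun _ => and_congr_right fun hz => ?_
  have : (fun k => deleteTwos z (k + 1)) = deleteTwos fun n => z (n + 1) := by
    funext k
    simp only [deleteTwos]
    rw [nth_succ_of_head hz h0]
  rw [this]

theorem measurableSet_deletionCyl (σ : List Bool) : MeasurableSet (deletionCyl σ) := by
  have hne (m : ℕ) : MeasurableSet {z : ℕ → Fin 3 | z m ≠ 2} :=
    measurableSet_coordinate m (· ≠ 2)
  have hcount (m : ℕ) : Measurable fun z : ℕ → Fin 3 => Nat.count (fun n => z n ≠ 2) m := by
    induction m with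
    | zero => simp
    | succ m ih =>
      simp only [Nat.count_succ]
      exact ih.add (Measurable.ite (hne m) measurable_const measurable_const)
  have key : deletionCyl σ = {z | ∀ N, ∃ n, N ≤ n ∧ z n ≠ 2} ∩
      {z | ∀ (k : ℕ) (h : k < σ.length), ∃ m, Nat.count (fun n => z n ≠ 2) m = k ∧ z m ≠ 2 ∧
        decide (z m = 1) = σ[k]} := by
    ext z
    simp only [deletionCyl, Set.mem_inter_iff, Set.mem_ofPred_eq, mem_cyl_iff,
      ← Nat.frequently_atTop_iff_infinite, Filter.frequently_atTop]
    refine and_congr_right fun hz => forall₂_congr fun k hk => ?_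
    have hinf : {n | z n ≠ 2}.Infinite := by
      rw [← Nat.frequently_atTop_iff_infinite, Filter.frequently_atTop]
      exact hz
    constructor
    · intro h
      exact ⟨_, Nat.count_nth_of_infinite hinf k, Nat.nth_mem_of_infinite hinf k, h⟩
    · rintro ⟨m, hm, h2, h1⟩
      rw [← h1, deleteTwos, ← hm, Nat.nth_count (p := fun n => z n ≠ 2) h2]
  rw [key]
  refine MeasurableSet.inter ?_ ?_
  · simp only [Set.ofPred_forall, Set.ofPred_exists]
    exact MeasurableSet.iInter fun N => MeasurableSet.iUnion fun n =>
      (MeasurableSet.const _).inter (hne n)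
  · simp only [Set.ofPred_forall, Set.ofPred_exists]
    refine MeasurableSet.iInter fun k => MeasurableSet.iInter fun hk => MeasurableSet.iUnion
      fun m => (hcount m (measurableSet_singleton k)).inter ((hne m).inter ?_)
    exact measurableSet_coordinate m fun a => decide (a = 1) = σ[k]

theorem IsUniformTernary.measure_deletionCyl {μ : Measure (ℕ → Fin 3)} (hμ : IsUniformTernary μ)
    (σ : List Bool) : μ (deletionCyl σ) = (1 / 2 : ℝ≥0∞) ^ σ.length := by
  induction σ with
  | nil =>
    have hm := measurableSet_deletionCyl []
    have : IsProbabilityMeasure μ := ⟨hμ.measure_univ⟩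
    rw [List.length_nil, pow_zero, ← prob_compl_eq_zero_iff hm]
    convert! hμ.measure_eventually_two using 3
    ext z
    simp [deletionCyl, cyl, initSeg]
  | cons b σ ih =>
    have : IsProbabilityMeasure μ := ⟨hμ.measure_univ⟩
    have hm := measurableSet_deletionCyl (b :: σ)
    have hsplit : deletionCyl (b :: σ) =
        {z | z 0 = 2 ∧ (fun n => z (n + 1)) ∈ deletionCyl (b :: σ)} ∪
        {z | z 0 = (if b then 1 else 0) ∧ (fun n => z (n + 1)) ∈ deletionCyl σ} := by
      ext z
      by_cases h0 : z 0 = 2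
      · rw [deletionCyl_of_head_two h0]
        cases b <;> simp [h0]
      · rw [deletionCyl_cons_of_head_ne_two h0]
        have : decide (z 0 = 1) = b ↔ z 0 = if b then 1 else 0 := by
          generalize z 0 = a at h0
          clear hm ih
          revert a b
          decide
        simp [h0, this]
    have hdisj : Disjoint {z : ℕ → Fin 3 | z 0 = 2 ∧ (fun n => z (n + 1)) ∈ deletionCyl (b :: σ)}
        {z | z 0 = (if b then 1 else 0) ∧ (fun n => z (n + 1)) ∈ deletionCyl σ} := by
      rw [Set.disjoint_left]
      rintro z ⟨h1, -⟩ ⟨h2, -⟩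
      rw [h1] at h2
      cases b <;> simp at h2
    have hm' : MeasurableSet {z : ℕ → Fin 3 | z 0 = (if b then 1 else 0) ∧
        (fun n => z (n + 1)) ∈ deletionCyl σ} :=
      (measurableSet_coordinate 0 (· = if b then 1 else 0)).inter
        ((by fun_prop : Measurable fun (z : ℕ → Fin 3) n => z (n + 1))
          (measurableSet_deletionCyl σ))
    have hrec := measure_union hdisj hm' (μ := μ)
    rw [← hsplit, hμ.measure_head_inter_shift _ hm,
      hμ.measure_head_inter_shift _ (measurableSet_deletionCyl σ), ih] at hrec
    have hfin : μ (deletionCyl (b :: σ)) ≠ ⊤ := measure_ne_top _ _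
    generalize μ (deletionCyl (b :: σ)) = t at hrec hfin
    rw [List.length_cons, pow_succ, ← ENNReal.toReal_eq_toReal_iff' hfin (by finiteness)]
    have hreal := congrArg ENNReal.toReal hrec
    rw [ENNReal.toReal_add (by finiteness) (by finiteness)] at hreal
    simp only [ENNReal.toReal_mul, ENNReal.toReal_inv, ENNReal.toReal_pow, ENNReal.toReal_div,
      ENNReal.toReal_ofNat, ENNReal.toReal_one] at hreal ⊢
    linarith

theorem initSeg_succ (y : ℕ → Bool) (n : ℕ) : initSeg y (n + 1) = initSeg y n ++ [y n] := by
  simp [initSeg, List.range_succ]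

theorem strVal_initSeg_succ (y : ℕ → Bool) (n : ℕ) :
    strVal (initSeg y (n + 1)) = 2 * strVal (initSeg y n) + (y n).toNat := by
  simp [strVal, initSeg_succ]

theorem strIdx_initSeg (y : ℕ → Bool) (n : ℕ) :
    strIdx (initSeg y n) = 2 ^ n + strVal (initSeg y n) - 1 := by
  simp [strIdx, initSeg]

theorem strictMono_strIdx_initSeg (y : ℕ → Bool) :
    StrictMono fun n => strIdx (initSeg y (n + 1)) - 1 := by
  refine strictMono_nat_of_lt_succ fun n => ?_
  have : 0 < 2 ^ n := by positivity
  simp only [strIdx_initSeg, strVal_initSeg_succ, pow_succ]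
  omega

theorem measurable_strIdx_initSeg (n : ℕ) : Measurable fun y => strIdx (initSeg y n) := by
  have hv : Measurable fun y => strVal (initSeg y n) := by
    induction n with
    | zero => simp [initSeg]
    | succ n ih =>
      simp only [strVal_initSeg_succ]
      exact (ih.const_mul 2).add ((measurable_of_countable Bool.toNat).comp
        (measurable_pi_apply n))
  simp only [strIdx_initSeg]
  exact (measurable_of_countable fun v => 2 ^ n + v - 1).comp hv

theorem measurable_flabel : Measurable fun p : (ℕ → Fin 3) × (ℕ → Bool) => flabel p.1 p.2 := by
  refine measurable_pi_lambda _ fun n => ?_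
  have heval : Measurable fun q : (ℕ → Fin 3) × ℕ => q.1 (q.2 - 1) :=
    measurable_from_prod_countable_left fun m => measurable_pi_apply (m - 1)
  exact heval.comp (measurable_fst.prodMk ((measurable_strIdx_initSeg (n + 1)).comp
    measurable_snd))

/-- Let `λ₃` (resp. `λ₂`) be the uniform product measure on `{0,1,2}^ω` (resp. `{0,1}^ω`),
characterized by its values on cylinders.  For every finite binary string `σ`, the integral
over `x` of `λ₂({y ∈ dom F_x : F_x(y) ∈ [σ]})` with respect to `λ₃` equals `2^{-|σ|}`:
the averaged pushforward measure has barycenter `λ₂`. -/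
theorem barycenter_of_pushforwards
    (μ3 : Measure (ℕ → Fin 3)) (μ2 : Measure (ℕ → Bool))
    [IsProbabilityMeasure μ3] [IsProbabilityMeasure μ2]
    (h3 : ∀ (n : ℕ) (w : ℕ → Fin 3), μ3 {x | ∀ i < n, x i = w i} = (1 / 3 : ℝ≥0∞) ^ n)
    (h2 : ∀ (n : ℕ) (w : ℕ → Bool), μ2 {y | ∀ i < n, y i = w i} = (1 / 2 : ℝ≥0∞) ^ n)
    (σ : List Bool) :
    ∫⁻ x, μ2 {y | Fdom x y ∧ Fapp x y ∈ cyl σ} ∂μ3 = (1 / 2 : ℝ≥0∞) ^ σ.length := by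
  have hμ : IsUniformTernary μ3 := h3
  have hS : MeasurableSet ((fun p : (ℕ → Fin 3) × (ℕ → Bool) => flabel p.1 p.2) ⁻¹'
      deletionCyl σ) := measurable_flabel (measurableSet_deletionCyl σ)
  calc ∫⁻ x, μ2 {y | Fdom x y ∧ Fapp x y ∈ cyl σ} ∂μ3
      = (μ3.prod μ2) ((fun p => flabel p.1 p.2) ⁻¹' deletionCyl σ) :=
        (Measure.prod_apply hS).symm
    _ = ∫⁻ y, μ3 {x | flabel x y ∈ deletionCyl σ} ∂μ2 := Measure.prod_apply_symm hS
    _ = ∫⁻ _, (1 / 2 : ℝ≥0∞) ^ σ.length ∂μ2 := by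
        refine lintegral_congr fun y => ?_
        rw [← hμ.measure_deletionCyl σ]
        conv_rhs => rw [← hμ.map_injective (strictMono_strIdx_initSeg y).injective]
        have hy : Measurable fun (x : ℕ → Fin 3) n => x (strIdx (initSeg y (n + 1)) - 1) :=
          measurable_pi_lambda _ fun n => measurable_pi_apply _
        exact (Measure.map_apply hy (measurableSet_deletionCyl σ)).symm
    _ = (1 / 2 : ℝ≥0∞) ^ σ.length := by simp
end
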